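/- arXiv:1209.3949 — 11 statements merged into one kernel-verified Lean document; each statement's English description precedes it below -/
import Mathlib

section
/- For every integer m ≥ 1 and every real v > 0, the function φ(s) = −(1/(4π))·[(s/v)·c_m(v,s)·I_m(v,s) − 2πm·c_m(v,s)·(I_m(v,s) + J_m(v,s))], defined for real s > 0, satisfies φ(1) = σ(m)·e^{−2πmv}. (This says that the m-th Fourier coefficient of the weight 2 Eisenstein series E₂(τ,1) equals a(v,1,m) = σ(m) for m > 0.) -/
open Real MeasureTheory Set

/-- The generalized divisor sum `σ*_ν(m) = m^ν · Σ_{d∣m} d^{−2ν}`. -/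
noncomputable def sigmaStar (m : ℕ) (ν : ℝ) : ℝ :=
  (m : ℝ) ^ ν * ∑ d ∈ m.divisors, (d : ℝ) ^ (-(2 * ν))

/-- The coefficient `c_m(v,s) = 2·σ*_{s−1/2}(m)·(πmv)^s/(Γ(s)·√m)`. -/
noncomputable def cCoef (m : ℕ) (v s : ℝ) : ℝ :=
  2 * sigmaStar m (s - 1 / 2) * (π * m * v) ^ s / (Real.Gamma s * Real.sqrt m)

/-- `I_m(v,s) = ∫₁^∞ e^{−2πmvr}·(r²−1)^{s−1} dr`. -/
noncomputable def ICoef (m : ℕ) (v s : ℝ) : ℝ :=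
  ∫ r in Ioi (1 : ℝ), Real.exp (-(2 * π * m * v * r)) * (r ^ 2 - 1) ^ (s - 1)

/-- `J_m(v,s) = ∫₁^∞ e^{−2πmvr}·(r²−1)^{s−1}·r dr`. -/
noncomputable def JCoef (m : ℕ) (v s : ℝ) : ℝ :=
  ∫ r in Ioi (1 : ℝ), Real.exp (-(2 * π * m * v * r)) * (r ^ 2 - 1) ^ (s - 1) * r

theorem sum_divisors_inv (m : ℕ) (hm : m ≠ 0) :
    ∑ d ∈ m.divisors, (d : ℝ)⁻¹ = (∑ d ∈ m.divisors, (d : ℝ)) / m := by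
  rw [← Nat.sum_div_divisors m (fun d => (d : ℝ)), Finset.sum_div]
  refine Finset.sum_congr rfl fun d hd => ?_
  have hdvd := Nat.dvd_of_mem_divisors hd
  have hd0 : (d : ℝ) ≠ 0 := by exact_mod_cast (Nat.pos_of_mem_divisors hd).ne'
  have hm0 : (m : ℝ) ≠ 0 := by exact_mod_cast hm
  rw [Nat.cast_div hdvd hd0]
  field_simp

theorem cCoef_one (m : ℕ) (hm : m ≠ 0) (v : ℝ) :
    cCoef m v 1 = 2 * π * v * ∑ d ∈ m.divisors, (d : ℝ) := by
  have hm0 : (0 : ℝ) < m := by exact_mod_cast Nat.pos_of_ne_zero hm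
  have hsqrt := (Real.sqrt_pos.2 hm0).ne'
  have hσ : sigmaStar m (1 - 1 / 2) = √m * ((∑ d ∈ m.divisors, (d : ℝ)) / m) := by
    rw [sigmaStar, ← sum_divisors_inv m hm, Real.sqrt_eq_rpow]
    norm_num [Real.rpow_neg_one]
  rw [cCoef, hσ, Real.rpow_one, Real.Gamma_one]
  field_simp

theorem integral_Ioi_exp_neg_mul_mul {a : ℝ} (ha : 0 < a) :
    ∫ r in Ioi (1 : ℝ), Real.exp (-(a * r)) * r = Real.exp (-a) * (1 / a + 1 / a ^ 2) := by
  have hderiv (r : ℝ) : HasDerivAt (fun r => -(r / a + 1 / a ^ 2) * Real.exp (-(a * r)))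
      (Real.exp (-(a * r)) * r) r := by
    have h₁ : HasDerivAt (fun r => -(r / a + 1 / a ^ 2)) (-(1 / a)) r :=
      (((hasDerivAt_id r).div_const a).add_const _).neg
    have h₂ : HasDerivAt (fun r => Real.exp (-(a * r))) (Real.exp (-(a * r)) * -(a * 1)) r :=
      (((hasDerivAt_id r).const_mul a).neg).exp
    refine (h₁.mul h₂).congr_deriv ?_
    field_simp
    ring
  have hlim : Filter.Tendsto (fun r => -(r / a + 1 / a ^ 2) * Real.exp (-(a * r)))
      Filter.atTop (nhds 0) := by
    have hatTop := Filter.tendsto_id.const_mul_atTop (β := ℝ) ha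
    have h₁ := (Real.tendsto_pow_mul_exp_neg_atTop_nhds_zero 1).comp hatTop
    have h₀ := Real.tendsto_exp_neg_atTop_nhds_zero.comp hatTop
    have h := (h₁.add h₀).const_mul (-(1 / a ^ 2))
    rw [add_zero, mul_zero] at h
    refine h.congr fun r => ?_
    simp only [Function.comp_apply, id, pow_one]
    field_simp
  rw [integral_Ioi_of_hasDerivAt_of_nonneg' (fun r _ => hderiv r)
    (fun r hr => mul_nonneg (Real.exp_pos _).le (zero_le_one.trans (le_of_lt hr))) hlim]
  simp only [mul_one]
  ring

theorem ICoef_one {m : ℕ} {v : ℝ} (h : 0 < 2 * π * m * v) :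
    ICoef m v 1 = Real.exp (-(2 * π * m * v)) / (2 * π * m * v) := by
  have := integral_exp_mul_Ioi (neg_neg_of_pos h) 1
  simpa [ICoef, neg_div_neg_eq] using this

theorem JCoef_one {m : ℕ} {v : ℝ} (h : 0 < 2 * π * m * v) :
    JCoef m v 1 = Real.exp (-(2 * π * m * v)) *
      (1 / (2 * π * m * v) + 1 / (2 * π * m * v) ^ 2) := by
  rw [← integral_Ioi_exp_neg_mul_mul h]
  simp [JCoef]

/-- The `m`-th Fourier coefficient of `E₂(τ,1)` equals `σ(m)` for `m > 0`:
`φ(1) = σ(m)·e^{−2πmv}`. -/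
theorem fourier_coeff_E2_at_one_pos (m : ℕ) (hm : 1 ≤ m) (v : ℝ) (hv : 0 < v) :
    (fun s : ℝ => -(1 / (4 * π)) *
        (s / v * cCoef m v s * ICoef m v s -
          2 * π * m * cCoef m v s * (ICoef m v s + JCoef m v s))) 1 =
      (∑ d ∈ m.divisors, (d : ℝ)) * Real.exp (-(2 * π * m * v)) := by
  have hm0 : (0 : ℝ) < m := by exact_mod_cast hm
  have hpos : 0 < 2 * π * m * v := by positivity
  beta_reduce
  rw [cCoef_one m (Nat.one_le_iff_ne_zero.1 hm), ICoef_one hpos, JCoef_one hpos]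
  field_simp
  ring
end

section
/- For every integer m ≥ 1 and every real v > 0, the function φ(s) = −(1/(4π))·[(s/v)·c_m(v,s)·I_m(v,s) − 2πm·c_m(v,s)·(I_m(v,s) + J_m(v,s))], defined for real s > 0, is differentiable at s = 1 and its derivative there equals φ'(1) = e^{−2πmv}·( σ(m)/(4πmv) + 2·Σ_{d∣m} d·log d − σ(m)·log m ). (This computes the m-th Fourier coefficient a'(v,1,m) = σ(m)·(1/(4πmv) + σ'(m)/σ(m)) of the s-derivative E₂'(τ,1), for m > 0.) -/
open Real MeasureTheory Set

open Filter Topology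

/-- For `|s - 1| < 1/2`, the derivative `log x * x ^ (s - 1)` of a power is dominated by an
integrable power as soon as the base is comparable to `t`. -/
lemma abs_log_mul_rpow_le {t x s : ℝ} (ht : 0 < t) (htx : t ≤ x) (hxt : x ≤ (t + 2) ^ 2)
    (hs : s ∈ Ioo (1 / 2 : ℝ) (3 / 2)) :
    |log x * x ^ (s - 1)| ≤ 4 * (t ^ (-3 / 4 : ℝ) * (t + 2) ^ 3) := by
  have hx : 0 < x := ht.trans_le htx
  obtain ⟨hs1, hs2⟩ := hs
  rw [abs_mul, abs_of_pos (rpow_pos_of_pos hx _)]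
  rcases le_total 1 x with h1 | h1
  · rw [abs_of_nonneg (log_nonneg h1)]
    have hlog : log x ≤ 4 * x ^ (1 / 4 : ℝ) := by
      have := log_le_rpow_div hx.le (show (0 : ℝ) < 1 / 4 by norm_num)
      linarith
    have hone : (1 : ℝ) ≤ t ^ (-3 / 4 : ℝ) * (t + 2) := by
      have h2 : t ^ (3 / 4 : ℝ) ≤ t + 2 := by
        calc t ^ (3 / 4 : ℝ) ≤ (t + 2) ^ (3 / 4 : ℝ) :=
              rpow_le_rpow ht.le (by linarith) (by norm_num)
          _ ≤ (t + 2) ^ (1 : ℝ) := rpow_le_rpow_of_exponent_le (by linarith) (by norm_num)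
          _ = t + 2 := rpow_one _
      calc (1 : ℝ) = t ^ (-3 / 4 : ℝ) * t ^ (3 / 4 : ℝ) := by
            rw [← rpow_add ht]; norm_num
        _ ≤ _ := by gcongr
    calc log x * x ^ (s - 1) ≤ 4 * x ^ (1 / 4 : ℝ) * x ^ (1 / 2 : ℝ) := by
          have := rpow_le_rpow_of_exponent_le h1 (show s - 1 ≤ 1 / 2 by linarith)
          gcongr
      _ = 4 * x ^ (3 / 4 : ℝ) := by rw [mul_assoc, ← rpow_add hx]; norm_num
      _ ≤ 4 * x ^ (1 : ℝ) := by
          have := rpow_le_rpow_of_exponent_le h1 (show (3 / 4 : ℝ) ≤ 1 by norm_num)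
          gcongr
      _ ≤ 4 * (1 * (t + 2) ^ 2) := by rw [rpow_one]; linarith
      _ ≤ 4 * ((t ^ (-3 / 4 : ℝ) * (t + 2)) * (t + 2) ^ 2) := by gcongr
      _ = _ := by ring
  · have hlog : |log x| ≤ 4 * x ^ (-1 / 4 : ℝ) := by
      have := log_le_rpow_div (inv_pos.2 hx).le (show (0 : ℝ) < 1 / 4 by norm_num)
      rw [log_inv, inv_rpow hx.le, ← rpow_neg hx.le] at this
      rw [abs_of_nonpos (log_nonpos hx.le h1), show (-1 / 4 : ℝ) = -(1 / 4) by norm_num]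
      linarith
    have hone : (1 : ℝ) ≤ (t + 2) ^ 3 := one_le_pow₀ (by linarith)
    calc |log x| * x ^ (s - 1) ≤ 4 * x ^ (-1 / 4 : ℝ) * x ^ (-1 / 2 : ℝ) := by
          have := rpow_le_rpow_of_exponent_ge hx h1 (show (-1 / 2 : ℝ) ≤ s - 1 by linarith)
          gcongr
      _ = 4 * x ^ (-3 / 4 : ℝ) := by rw [mul_assoc, ← rpow_add hx]; norm_num
      _ ≤ 4 * t ^ (-3 / 4 : ℝ) := by
          have := rpow_le_rpow_of_nonpos ht htx (show (-3 / 4 : ℝ) ≤ 0 by norm_num)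
          gcongr
      _ ≤ _ := by
          have := rpow_nonneg ht.le (-3 / 4 : ℝ)
          nlinarith

lemma integrableOn_pow_mul_rpow_mul_exp {a p : ℝ} (ha : 0 < a) (hp : -1 < p) (n : ℕ) :
    IntegrableOn (fun t : ℝ => t ^ n * (t ^ p * exp (-(a * t)))) (Ioi 0) := by
  have h := integrableOn_rpow_mul_exp_neg_mul_rpow (p := 1) (s := p + n) (b := a)
    (by have := n.cast_nonneg (α := ℝ); linarith) one_pos ha
  refine h.congr_fun (fun t ht => ?_) measurableSet_Ioi
  simp only [rpow_one, neg_mul]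
  rw [rpow_add ht, rpow_natCast]
  ring

/-- Differentiation under the integral sign at `s = 1` for
`∫₀^∞ e^{-at} b(t)^{s-1} w(t) dt`. -/
lemma hasDerivAt_integral_exp_mul_rpow {a : ℝ} (ha : 0 < a) {b w : ℝ → ℝ}
    (hb : Continuous b) (hw : Continuous w) (htb : ∀ t, 0 < t → t ≤ b t)
    (hbt : ∀ t, 0 < t → b t ≤ (t + 2) ^ 2) (hwt : ∀ t, 0 < t → |w t| ≤ t + 2) :
    IntegrableOn (fun t => exp (-(a * t)) * log (b t) * w t) (Ioi 0) ∧
      HasDerivAt (fun s : ℝ => ∫ t in Ioi (0 : ℝ), exp (-(a * t)) * b t ^ (s - 1) * w t)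
        (∫ t in Ioi (0 : ℝ), exp (-(a * t)) * log (b t) * w t) 1 := by
  have hpow (n : ℕ) : IntegrableOn (fun t : ℝ => t ^ n * exp (-(a * t))) (Ioi 0) := by
    simpa using integrableOn_pow_mul_rpow_mul_exp ha (p := 0) (by norm_num) n
  have hmeas (s : ℝ) : AEStronglyMeasurable
      (fun t => exp (-(a * t)) * b t ^ (s - 1) * w t) (volume.restrict (Ioi 0)) := by
    have := hb.measurable
    have := hw.measurable
    exact Measurable.aestronglyMeasurable (by fun_prop)
  have hmeas' (s : ℝ) : AEStronglyMeasurable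
      (fun t => exp (-(a * t)) * (log (b t) * b t ^ (s - 1)) * w t)
      (volume.restrict (Ioi 0)) := by
    have := hb.measurable
    have := hw.measurable
    exact Measurable.aestronglyMeasurable (by fun_prop)
  have key := hasDerivAt_integral_of_dominated_loc_of_deriv_le
    (μ := volume.restrict (Ioi (0 : ℝ))) (x₀ := (1 : ℝ)) (s := Ioo (1 / 2 : ℝ) (3 / 2))
    (F := fun s t => exp (-(a * t)) * b t ^ (s - 1) * w t)
    (F' := fun s t => exp (-(a * t)) * (log (b t) * b t ^ (s - 1)) * w t)
    (bound := fun t => exp (-(a * t)) * (4 * (t ^ (-3 / 4 : ℝ) * (t + 2) ^ 3)) * (t + 2))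
    (Ioo_mem_nhds (by norm_num) (by norm_num)) (Eventually.of_forall hmeas) ?_ (hmeas' 1) ?_ ?_ ?_
  · simpa [IntegrableOn] using key
  · have hbd : IntegrableOn (fun t : ℝ => t ^ 1 * exp (-(a * t)) + 2 * (t ^ 0 * exp (-(a * t))))
        (Ioi 0) := (hpow 1).add ((hpow 0).const_mul 2)
    refine Integrable.mono' hbd (hmeas 1) ?_
    filter_upwards [self_mem_ae_restrict measurableSet_Ioi] with t ht
    have := hwt t ht
    simp only [sub_self, rpow_zero, mul_one, norm_mul, Real.norm_eq_abs, abs_exp]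
    calc exp (-(a * t)) * |w t| ≤ exp (-(a * t)) * (t + 2) := by gcongr
      _ = _ := by ring
  · filter_upwards [self_mem_ae_restrict measurableSet_Ioi] with t ht s hs
    have h1 := hwt t ht
    have h2 := abs_log_mul_rpow_le ht (htb t ht) (hbt t ht) hs
    rw [norm_mul, norm_mul, Real.norm_eq_abs, Real.norm_eq_abs, Real.norm_eq_abs, abs_exp]
    have : 0 ≤ exp (-(a * t)) * (4 * (t ^ (-3 / 4 : ℝ) * (t + 2) ^ 3)) := by
      have : 0 < t := ht
      positivity
    gcongr
  · have h (n : ℕ) := integrableOn_pow_mul_rpow_mul_exp ha (p := -3 / 4) (by norm_num) n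
    have hsum := (((((h 4).const_mul 4).add ((h 3).const_mul 32)).add ((h 2).const_mul 96)).add
      ((h 1).const_mul 128)).add ((h 0).const_mul 64)
    refine IntegrableOn.congr_fun hsum (fun t _ => ?_) measurableSet_Ioi
    simp only [Pi.add_apply]
    ring
  · filter_upwards [self_mem_ae_restrict measurableSet_Ioi] with t ht s _
    have hpos : 0 < b t := lt_of_lt_of_le ht (htb t ht)
    have h := ((hasDerivAt_id s).sub_const 1).const_rpow hpos
    refine ((h.const_mul (exp (-(a * t)))).mul_const (w t)).congr_deriv ?_
    simp

/-- `∫₀^∞ e^{-at} log t dt = -(γ + log a)/a`. -/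
lemma integral_exp_mul_log {a : ℝ} (ha : 0 < a) :
    IntegrableOn (fun t => exp (-(a * t)) * log t) (Ioi 0) ∧
      ∫ t in Ioi (0 : ℝ), exp (-(a * t)) * log t = -(eulerMascheroniConstant + log a) / a := by
  obtain ⟨h_integrable, hder⟩ := hasDerivAt_integral_exp_mul_rpow ha
    (b := fun t => t) (w := fun _ => 1)
    continuous_id continuous_const (fun t _ => le_rfl) (fun t ht => by nlinarith)
    (fun t ht => by simp; linarith)
  simp only [mul_one] at h_integrable hder
  refine ⟨h_integrable, ?_⟩
  have hG : HasDerivAt (fun s : ℝ => (1 / a) ^ s * Real.Gamma s)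
      (log (1 / a) * (1 / a) ^ (1 : ℝ) * Real.Gamma 1 +
        (1 / a) ^ (1 : ℝ) * (-eulerMascheroniConstant)) 1 := by
    have h := ((hasDerivAt_id (1 : ℝ)).const_rpow (one_div_pos.2 ha)).mul hasDerivAt_Gamma_one
    refine h.congr_deriv ?_
    simp
  have heq : (fun s : ℝ => ∫ t in Ioi (0 : ℝ), exp (-(a * t)) * t ^ (s - 1)) =ᶠ[𝓝 1]
      fun s : ℝ => (1 / a) ^ s * Real.Gamma s := by
    filter_upwards [lt_mem_nhds (zero_lt_one' ℝ)] with s hs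
    rw [← integral_rpow_mul_exp_neg_mul_Ioi hs ha]
    exact integral_congr_ae (Eventually.of_forall fun t => mul_comm _ _)
  rw [hder.unique (hG.congr_of_eventuallyEq heq), Real.Gamma_one, rpow_one, one_div, log_inv]
  field_simp
  ring

lemma integral_exp_mul_log_quadratic {a : ℝ} (ha : 0 < a) :
    ∫ t in Ioi (0 : ℝ), exp (-(a * t)) * log (t * (t + 2)) * (1 - 2 * a - a * t) =
      2 * eulerMascheroniConstant + 2 * log a - 2 / a - 2 * log 2 := by
  obtain ⟨hL, hLval⟩ := integral_exp_mul_log ha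
  have hexp : IntegrableOn (fun t : ℝ => exp (-(a * t))) (Ioi 0) := by
    simpa using integrableOn_pow_mul_rpow_mul_exp ha (p := 0) (by norm_num) 0
  have hexpval : ∫ t in Ioi (0 : ℝ), exp (-(a * t)) = 1 / a := by
    have h := integral_exp_mul_Ioi (neg_lt_zero.2 ha) 0
    simpa [neg_mul] using h
  have hD (w : ℝ → ℝ) (hw : Continuous w) (hwt : ∀ t, 0 < t → |w t| ≤ t + 2) :
      IntegrableOn (fun t => exp (-(a * t)) * log (t * (t + 2)) * w t) (Ioi 0) :=
    (hasDerivAt_integral_exp_mul_rpow ha (b := fun t => t * (t + 2)) (by fun_prop) hw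
      (fun t ht => by nlinarith) (fun t ht => by nlinarith) hwt).1
  have h_integrable : IntegrableOn
      (fun t => exp (-(a * t)) * log (t * (t + 2)) * (1 - 2 * a - a * t)) (Ioi 0) := by
    have h0 := (hD (fun _ => 1) (by fun_prop) fun t ht => by simp; linarith).const_mul (1 - 2 * a)
    have h1 := (hD (fun t => t) (by fun_prop) fun t ht => by
      rw [abs_of_pos ht]; linarith).const_mul a
    refine IntegrableOn.congr_fun (h0.sub h1) (fun t _ => ?_) measurableSet_Ioi
    simp only [Pi.sub_apply]
    ring
  have hrest : IntegrableOn
      (fun t => 2 * exp (-(a * t)) + 2 * a * (exp (-(a * t)) * log t)) (Ioi 0) :=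
    (hexp.const_mul 2).add (hL.const_mul (2 * a))
  have hFTC := integral_Ioi_of_hasDerivAt_of_tendsto (a := 0) (m := 0)
    (f := fun t => log (t + 2) * ((t + 2) * exp (-(a * t))) + t * log t * exp (-(a * t)))
    (f' := fun t => exp (-(a * t)) * log (t * (t + 2)) * (1 - 2 * a - a * t) +
      (2 * exp (-(a * t)) + 2 * a * (exp (-(a * t)) * log t))) ?_ ?_
    (h_integrable.add hrest) ?_
  · rw [integral_add h_integrable hrest,
      integral_add (hexp.const_mul 2) (hL.const_mul (2 * a)), integral_const_mul,
      integral_const_mul, hLval, hexpval] at hFTC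
    have h2 : 2 * a * (-(eulerMascheroniConstant + log a) / a) =
        -(2 * (eulerMascheroniConstant + log a)) := by field_simp
    rw [h2] at hFTC
    simp only [zero_add, mul_zero, neg_zero, exp_zero, mul_one, zero_mul, add_zero] at hFTC
    linear_combination hFTC
  · have h1 : ContinuousAt (fun t : ℝ => log (t + 2)) 0 :=
      ContinuousAt.log (by fun_prop) (by norm_num)
    have h2 : ContinuousAt (fun t : ℝ => t * log t) 0 := continuous_mul_log.continuousAt
    exact ((h1.mul (by fun_prop)).add (h2.mul (by fun_prop))).continuousWithinAt
  · intro t ht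
    have ht0 : t ≠ 0 := ne_of_gt ht
    have ht2 : t + 2 ≠ 0 := by have : 0 < t := ht; positivity
    have he : HasDerivAt (fun t : ℝ => exp (-(a * t))) (exp (-(a * t)) * -(a * 1)) t :=
      ((hasDerivAt_id t).const_mul a).neg.exp
    have hadd : HasDerivAt (fun t : ℝ => t + 2) 1 t := (hasDerivAt_id t).add_const 2
    have h := ((hadd.log ht2).mul (hadd.mul he)).add
      (((hasDerivAt_id t).mul (hasDerivAt_log ht0)).mul he)
    refine h.congr_deriv ?_
    simp only [id, Pi.mul_apply]
    rw [log_mul ht0 ht2]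
    field_simp
    ring
  · have hsq : Tendsto (fun t : ℝ => (t + 2) ^ 2 * exp (-(a * t)) + t ^ 2 * exp (-(a * t)))
        atTop (𝓝 0) := by
      have h (n : ℕ) : Tendsto (fun t : ℝ => t ^ n * exp (-(a * t))) atTop (𝓝 0) := by
        simpa using tendsto_rpow_mul_exp_neg_mul_atTop_nhds_zero n a ha
      have := (((h 2).const_mul 2).add ((h 1).const_mul 4)).add ((h 0).const_mul 4)
      simp only [mul_zero, add_zero] at this
      refine this.congr fun t => ?_
      ring
    refine squeeze_zero' ?_ ?_ hsq
    · filter_upwards [eventually_ge_atTop 1] with t ht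
      have h1 := log_nonneg ht
      have h2 := log_nonneg (show 1 ≤ t + 2 by linarith)
      positivity
    · filter_upwards [eventually_ge_atTop 1] with t ht
      have h1 := log_le_self (show 0 ≤ t by linarith)
      have h2 := log_le_self (show 0 ≤ t + 2 by linarith)
      calc _ ≤ (t + 2) * ((t + 2) * exp (-(a * t))) + t * t * exp (-(a * t)) := by gcongr
        _ = _ := by ring

lemma integral_exp_mul_one_add {a : ℝ} (ha : 0 < a) :
    (∫ t in Ioi (0 : ℝ), exp (-(a * t)) = 1 / a) ∧
      ∫ t in Ioi (0 : ℝ), exp (-(a * t)) * (t + 1) = 1 / a + 1 / a ^ 2 := by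
  have hpow (n : ℕ) : IntegrableOn (fun t : ℝ => t ^ n * exp (-(a * t))) (Ioi 0) := by
    simpa using integrableOn_pow_mul_rpow_mul_exp ha (p := 0) (by norm_num) n
  have h0 : ∫ t in Ioi (0 : ℝ), exp (-(a * t)) = 1 / a := by
    have h := integral_exp_mul_Ioi (neg_lt_zero.2 ha) 0
    simpa [neg_mul] using h
  have h1 : ∫ t in Ioi (0 : ℝ), t ^ 1 * exp (-(a * t)) = 1 / a ^ 2 := by
    have h := integral_rpow_mul_exp_neg_mul_Ioi (a := 2) two_pos ha
    norm_num at h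
    simpa [Real.Gamma_two] using h
  refine ⟨h0, ?_⟩
  have hsum := integral_add (hpow 1) (hpow 0)
  simp only [pow_zero, one_mul] at hsum
  rw [h1, h0] at hsum
  rw [add_comm, ← hsum]
  exact integral_congr_ae (Eventually.of_forall fun t => by simp only; ring)

/-- Translating the half line `(1, ∞)` to `(0, ∞)`. -/
lemma integral_Ioi_one_eq_integral_Ioi_zero (f : ℝ → ℝ) :
    ∫ r in Ioi (1 : ℝ), f r = ∫ t in Ioi (0 : ℝ), f (t + 1) := by
  have h := (measurePreserving_add_right volume (1 : ℝ)).setIntegral_preimage_emb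
    (measurableEmbedding_addRight 1) f (Ioi 1)
  rw [← h]
  simp

lemma ICoef_eq (m : ℕ) (v s : ℝ) :
    ICoef m v s = exp (-(2 * π * m * v)) *
      ∫ t in Ioi (0 : ℝ), exp (-(2 * π * m * v * t)) * (t * (t + 2)) ^ (s - 1) * 1 := by
  rw [ICoef, integral_Ioi_one_eq_integral_Ioi_zero, ← integral_const_mul]
  congr 1 with t
  rw [show -(2 * π * m * v * (t + 1)) = -(2 * π * m * v) + -(2 * π * m * v * t) by ring, exp_add,
    show (t + 1) ^ 2 - 1 = t * (t + 2) by ring]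
  ring

lemma JCoef_eq (m : ℕ) (v s : ℝ) :
    JCoef m v s = exp (-(2 * π * m * v)) *
      ∫ t in Ioi (0 : ℝ), exp (-(2 * π * m * v * t)) * (t * (t + 2)) ^ (s - 1) * (t + 1) := by
  rw [JCoef, integral_Ioi_one_eq_integral_Ioi_zero, ← integral_const_mul]
  congr 1 with t
  rw [show -(2 * π * m * v * (t + 1)) = -(2 * π * m * v) + -(2 * π * m * v * t) by ring, exp_add,
    show (t + 1) ^ 2 - 1 = t * (t + 2) by ring]
  ring

/-- The combination `(s - a) I + (-a) J` with `a = 2πmv`, its value and derivative at `s = 1`. -/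
lemma hasDerivAt_ICoef_JCoef {m : ℕ} (hm : 1 ≤ m) {v a : ℝ} (hv : 0 < v)
    (ha : a = 2 * π * m * v) :
    ((1 - a) * ICoef m v 1 - a * JCoef m v 1 = -2 * exp (-a)) ∧
      HasDerivAt (fun s : ℝ => (s - a) * ICoef m v s - a * JCoef m v s)
        (exp (-a) * (2 * eulerMascheroniConstant + 2 * log a - 1 / a - 2 * log 2)) 1 := by
  have ha0 : 0 < a := by
    have : (0 : ℝ) < m := by exact_mod_cast hm
    rw [ha]; positivity
  simp only [ICoef_eq, JCoef_eq, ← ha]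
  obtain ⟨hi0, hd0⟩ := hasDerivAt_integral_exp_mul_rpow ha0 (b := fun t => t * (t + 2))
    (w := fun _ => 1) (by fun_prop) (by fun_prop) (fun t ht => by nlinarith)
    (fun t ht => by nlinarith) (fun t ht => by simp; linarith)
  obtain ⟨hi1, hd1⟩ := hasDerivAt_integral_exp_mul_rpow ha0 (b := fun t => t * (t + 2))
    (w := fun t => t + 1) (by fun_prop) (by fun_prop) (fun t ht => by nlinarith)
    (fun t ht => by nlinarith) (fun t ht => by rw [abs_of_pos (by linarith)]; linarith)
  obtain ⟨h0, h1⟩ := integral_exp_mul_one_add ha0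
  refine ⟨?_, ?_⟩
  · simp only [sub_self, rpow_zero, mul_one, h0, h1]
    field_simp
    ring
  · have h := (((hasDerivAt_id (1 : ℝ)).sub_const a).mul (hd0.const_mul (exp (-a)))).sub
      ((hd1.const_mul (exp (-a))).const_mul a)
    refine h.congr_deriv ?_
    have hq := integral_exp_mul_log_quadratic ha0
    have hsplit : ∫ t in Ioi (0 : ℝ), exp (-(a * t)) * log (t * (t + 2)) * (1 - 2 * a - a * t) =
        (1 - a) * (∫ t in Ioi (0 : ℝ), exp (-(a * t)) * log (t * (t + 2)) * 1) -
          a * ∫ t in Ioi (0 : ℝ), exp (-(a * t)) * log (t * (t + 2)) * (t + 1) := by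
      rw [← integral_const_mul, ← integral_const_mul,
        ← integral_sub (hi0.const_mul _) (hi1.const_mul _)]
      congr 1 with t
      ring
    rw [hsplit] at hq
    simp only [id, sub_self, rpow_zero, mul_one, h0] at hq ⊢
    linear_combination exp (-a) * hq

lemma sqrt_mul_sigmaStar_half {m : ℕ} (hm : 1 ≤ m) :
    √m * sigmaStar m (1 / 2) = ∑ d ∈ m.divisors, (d : ℝ) := by
  have hm0 : (0 : ℝ) < m := by exact_mod_cast hm
  rw [sigmaStar, ← mul_assoc, ← sqrt_eq_rpow, mul_self_sqrt hm0.le, Finset.mul_sum,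
    ← Nat.sum_div_divisors]
  refine Finset.sum_congr rfl fun d hd => ?_
  rw [Nat.cast_div (Nat.dvd_of_mem_divisors hd)
    (by exact_mod_cast (Nat.pos_of_mem_divisors hd).ne')]
  norm_num [rpow_neg_one]
  field_simp

lemma hasDerivAt_sigmaStar_half {m : ℕ} (hm : 1 ≤ m) :
    HasDerivAt (fun ν => √m * sigmaStar m ν)
      (2 * (∑ d ∈ m.divisors, (d : ℝ) * log d) - (∑ d ∈ m.divisors, (d : ℝ)) * log m)
      (1 / 2) := by
  have hm0 : (0 : ℝ) < m := by exact_mod_cast hm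
  have hsum : HasDerivAt (fun ν : ℝ => ∑ d ∈ m.divisors, (d : ℝ) ^ (-(2 * ν)))
      (∑ d ∈ m.divisors, -2 * (log d * (d : ℝ)⁻¹)) (1 / 2) := by
    refine HasDerivAt.fun_sum fun d hd => ?_
    have hd0 : (0 : ℝ) < d := by exact_mod_cast Nat.pos_of_mem_divisors hd
    refine ((((hasDerivAt_id (1 / 2 : ℝ)).const_mul 2).neg).const_rpow hd0).congr_deriv ?_
    norm_num [rpow_neg_one]
    ring
  have h := (((hasDerivAt_id (1 / 2 : ℝ)).const_rpow hm0).mul hsum).const_mul √m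
  refine h.congr_deriv ?_
  have hval := sqrt_mul_sigmaStar_half hm
  rw [sigmaStar] at hval
  have hflip : ∑ d ∈ m.divisors, (d : ℝ) * log d =
      ∑ d ∈ m.divisors, (m * (d : ℝ)⁻¹ * log m - m * (log d * (d : ℝ)⁻¹)) := by
    rw [← Nat.sum_div_divisors]
    refine Finset.sum_congr rfl fun d hd => ?_
    have hd0 : (d : ℝ) ≠ 0 := by exact_mod_cast (Nat.pos_of_mem_divisors hd).ne'
    rw [Nat.cast_div (Nat.dvd_of_mem_divisors hd) hd0, log_div hm0.ne' hd0]
    ring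
  have hflip' : ∑ d ∈ m.divisors, (m * (d : ℝ)⁻¹) = ∑ d ∈ m.divisors, (d : ℝ) := by
    rw [← Nat.sum_div_divisors m fun d => (d : ℝ)]
    refine Finset.sum_congr rfl fun d hd => ?_
    rw [Nat.cast_div (Nat.dvd_of_mem_divisors hd)
      (by exact_mod_cast (Nat.pos_of_mem_divisors hd).ne'), div_eq_mul_inv]
  rw [Finset.sum_sub_distrib, ← Finset.sum_mul, hflip', ← Finset.mul_sum] at hflip
  have hs : √(m : ℝ) * (m : ℝ) ^ (1 / 2 : ℝ) = m := by
    rw [← sqrt_eq_rpow, mul_self_sqrt hm0.le]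
  simp only [id, ← Finset.mul_sum, mul_one]
  linear_combination log m * hval - 2 * (∑ d ∈ m.divisors, log d * (d : ℝ)⁻¹) * hs - 2 * hflip

/-- The value and derivative of `s ↦ c_m(v,s)` at `s = 1`. -/
lemma hasDerivAt_cCoef {m : ℕ} (hm : 1 ≤ m) {v : ℝ} (hv : 0 < v) :
    cCoef m v 1 = 2 * π * v * ∑ d ∈ m.divisors, (d : ℝ) ∧
      HasDerivAt (cCoef m v)
        (2 * π * v * (2 * (∑ d ∈ m.divisors, (d : ℝ) * log d) -
            (∑ d ∈ m.divisors, (d : ℝ)) * log m +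
          (∑ d ∈ m.divisors, (d : ℝ)) * (log (π * m * v) + eulerMascheroniConstant))) 1 := by
  have hm0 : (0 : ℝ) < m := by exact_mod_cast hm
  have hx : 0 < π * m * v := by positivity
  have hc : cCoef m v = fun s =>
      2 / m * ((√m * sigmaStar m (s - 1 / 2)) * (π * m * v) ^ s / Real.Gamma s) := by
    funext s
    have hsq : √(m : ℝ) ≠ 0 := (sqrt_pos.2 hm0).ne'
    rw [cCoef]
    by_cases hG : Real.Gamma s = 0
    · simp [hG]
    field_simp
    rw [sq_sqrt hm0.le]
  have hval := sqrt_mul_sigmaStar_half hm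
  rw [hc]
  refine ⟨?_, ?_⟩
  · simp only [show (1 : ℝ) - 1 / 2 = 1 / 2 by norm_num, hval, rpow_one, Real.Gamma_one]
    field_simp
  · have h1 : HasDerivAt (fun s : ℝ => √m * sigmaStar m (s - 1 / 2)) _ 1 :=
      HasDerivAt.comp_sub_const (1 : ℝ) (1 / 2)
        (by rw [show (1 : ℝ) - 1 / 2 = 1 / 2 by norm_num]; exact hasDerivAt_sigmaStar_half hm)
    have h := ((h1.mul ((hasDerivAt_id (1 : ℝ)).const_rpow hx)).div hasDerivAt_Gamma_one
      (by simp)).const_mul (2 / (m : ℝ))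
    refine h.congr_deriv ?_
    simp only [id, Pi.mul_apply, show (1 : ℝ) - 1 / 2 = 1 / 2 by norm_num, hval, rpow_one,
      Real.Gamma_one]
    field_simp
    ring

/-- The `m`-th Fourier coefficient of `E₂'(τ,1)` for `m > 0`:
`φ'(1) = e^{−2πmv}·( σ(m)/(4πmv) + 2·Σ_{d∣m} d·log d − σ(m)·log m )`. -/
theorem fourier_coeff_E2_deriv_pos (m : ℕ) (hm : 1 ≤ m) (v : ℝ) (hv : 0 < v) :
    HasDerivAt (fun s : ℝ => -(1 / (4 * π)) *
        (s / v * cCoef m v s * ICoef m v s -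
          2 * π * m * cCoef m v s * (ICoef m v s + JCoef m v s)))
      (Real.exp (-(2 * π * m * v)) *
        ((∑ d ∈ m.divisors, (d : ℝ)) / (4 * π * m * v) +
          2 * (∑ d ∈ m.divisors, (d : ℝ) * Real.log d) -
          (∑ d ∈ m.divisors, (d : ℝ)) * Real.log m)) 1 := by
  have hm0 : (0 : ℝ) < m := by exact_mod_cast hm
  obtain ⟨hK, hK'⟩ := hasDerivAt_ICoef_JCoef hm hv rfl
  obtain ⟨hc, hc'⟩ := hasDerivAt_cCoef hm hv
  have h := (hc'.mul hK').const_mul (-(1 / (4 * π * v)))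
  have hlog : log (2 * π * m * v) = log 2 + log (π * m * v) := by
    rw [← log_mul two_ne_zero (by positivity)]
    ring_nf
  refine (h.congr_of_eventuallyEq (Eventually.of_forall fun s => ?_)).congr_deriv ?_
  · simp only [Pi.mul_apply]
    field_simp
    ring
  · rw [hK, hc, hlog]
    field_simp
    ring
end

section
/- For every real v > 0, the function a₁(s) = s·v^{s−1}·Λ(2s) is differentiable at s = 1 and its derivative there equals a₁'(1) = (π/6)·( 24·ζ'(−1) + γ − 1 + log(4πv) ), where ζ'(−1) is the derivative of the analytically continued Riemann zeta function at −1 and γ is the Euler–Mascheroni constant. -/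
open Real Complex

/-- The functional equation relates the derivatives of `ζ` at `2` and at `-1`. -/
theorem deriv_riemannZeta_two :
    deriv riemannZeta 2 = (π : ℂ) ^ 2 / 6 *
      (12 * deriv riemannZeta (-1) + (Real.eulerMascheroniConstant : ℂ) - 1
        + (Real.log (2 * π) : ℂ)) := by
  have hπ : (π : ℂ) ≠ 0 := by exact_mod_cast Real.pi_ne_zero
  have hz : HasDerivAt riemannZeta (deriv riemannZeta 2) 2 :=
    (differentiableAt_riemannZeta (by norm_num)).hasDerivAt
  have hz' : HasDerivAt riemannZeta (deriv riemannZeta (-1)) (1 - 2) := by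
    rw [show (1 : ℂ) - 2 = -1 by norm_num]
    exact (differentiableAt_riemannZeta (by norm_num)).hasDerivAt
  have hl : HasDerivAt (fun s : ℂ => riemannZeta (1 - s))
      (deriv riemannZeta (-1) * (-1)) 2 :=
    hz'.comp 2 ((hasDerivAt_id (2 : ℂ)).const_sub 1)
  have hΓ : HasDerivAt Complex.Gamma (1 - (Real.eulerMascheroniConstant : ℂ)) 2 := by
    have h := Complex.hasDerivAt_Gamma_nat 1
    norm_num at h
    convert h using 1
    ring
  have hp : HasDerivAt (fun s : ℂ => (2 * (π : ℂ)) ^ (-s))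
      ((2 * (π : ℂ)) ^ (-2 : ℂ) * Complex.log (2 * π) * (-1)) 2 :=
    (hasDerivAt_id (2 : ℂ)).neg.const_cpow (Or.inl (by simp [hπ]))
  have hc : HasDerivAt (fun s : ℂ => Complex.cos (π * s / 2)) 0 2 := by
    have h := (((hasDerivAt_id (2 : ℂ)).const_mul (π : ℂ)).div_const 2).ccos
    refine h.congr_deriv ?_
    rw [id_eq, mul_div_cancel_right₀ _ two_ne_zero, Complex.sin_pi, neg_zero, zero_mul]
  have hr := (((hp.const_mul 2).mul hΓ).mul hc).mul hz
  have heq : (fun s : ℂ => riemannZeta (1 - s)) =ᶠ[nhds 2]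
      fun s => 2 * (2 * (π : ℂ)) ^ (-s) * Complex.Gamma s * Complex.cos (π * s / 2)
        * riemannZeta s := by
    have hn : {s : ℂ | 0 < s.re ∧ s ≠ 1} ∈ nhds (2 : ℂ) :=
      ((isOpen_lt continuous_const Complex.continuous_re).inter isOpen_ne).mem_nhds
        (by norm_num)
    filter_upwards [hn] with s hs
    refine riemannZeta_one_sub (fun n h => ?_) hs.2
    have := hs.1
    simp only [h, Complex.neg_re, Complex.natCast_re] at this
    have h2 : (0 : ℝ) ≤ n := n.cast_nonneg
    linarith
  have h := hl.unique (hr.congr_of_eventuallyEq heq)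
  have hcos : Complex.cos (π * 2 / 2) = -1 := by simp
  have hG2 : Complex.Gamma 2 = 1 := by simp
  have hpow : (2 * (π : ℂ)) ^ (-2 : ℂ) = 1 / (4 * π ^ 2) := by
    rw [Complex.cpow_neg, show (2 : ℂ) = ((2 : ℕ) : ℂ) by norm_num, Complex.cpow_natCast]
    push_cast
    field_simp
    norm_num
  have hlog : Complex.log (2 * π) = (Real.log (2 * π) : ℂ) := by
    rw [Complex.ofReal_log (by positivity)]
    push_cast
    rfl
  simp only [Pi.mul_apply, hcos, hG2, hpow, hlog, riemannZeta_two] at h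
  field_simp at h ⊢
  linear_combination h / 2

/-- The function `a₁(s) = s·v^{s−1}·Λ(2s)` is differentiable at `s = 1` with derivative
`a₁'(1) = (π/6)·( 24·ζ'(−1) + γ − 1 + log(4πv) )`. -/
theorem deriv_a1_at_one (v : ℝ) (hv : 0 < v) :
    HasDerivAt (fun s : ℂ => s * (v : ℂ) ^ (s - 1) * completedRiemannZeta (2 * s))
      ((π : ℂ) / 6 * (24 * deriv riemannZeta (-1) +
        (Real.eulerMascheroniConstant : ℂ) - 1 + (Real.log (4 * π * v) : ℂ))) 1 := by
  have hπ : (π : ℂ) ≠ 0 := by exact_mod_cast Real.pi_ne_zero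
  have hv' : (v : ℂ) ≠ 0 := by exact_mod_cast hv.ne'
  have hz : HasDerivAt riemannZeta (deriv riemannZeta 2) (2 * 1) := by
    rw [mul_one]
    exact (differentiableAt_riemannZeta (by norm_num)).hasDerivAt
  have hz2 : HasDerivAt (fun s : ℂ => riemannZeta (2 * s)) (deriv riemannZeta 2 * (2 * 1)) 1 :=
    hz.comp 1 ((hasDerivAt_id (1 : ℂ)).const_mul 2)
  have hp : HasDerivAt (fun s : ℂ => (π : ℂ) ^ (-s))
      ((π : ℂ) ^ (-1 : ℂ) * Complex.log π * (-1)) 1 :=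
    (hasDerivAt_id (1 : ℂ)).neg.const_cpow (Or.inl hπ)
  have hvp : HasDerivAt (fun s : ℂ => (v : ℂ) ^ (s - 1))
      ((v : ℂ) ^ ((1 : ℂ) - 1) * Complex.log v * 1) 1 :=
    ((hasDerivAt_id (1 : ℂ)).sub_const 1).const_cpow (Or.inl hv')
  have hr := ((hasDerivAt_id (1 : ℂ)).mul hvp).mul
    ((hp.mul Complex.hasDerivAt_Gamma_one).mul hz2)
  have heq : (fun s : ℂ => s * (v : ℂ) ^ (s - 1) * completedRiemannZeta (2 * s)) =ᶠ[nhds 1]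
      fun s => s * (v : ℂ) ^ (s - 1) *
        ((π : ℂ) ^ (-s) * Complex.Gamma s * riemannZeta (2 * s)) := by
    have hn : {s : ℂ | 0 < s.re} ∈ nhds (1 : ℂ) :=
      (isOpen_lt continuous_const Complex.continuous_re).mem_nhds (by norm_num)
    filter_upwards [hn] with s hs
    have hs0 : 2 * s ≠ 0 := by
      rintro h
      have : s = 0 := by simpa using h
      simp [this] at hs
    have hG : Complex.Gammaℝ (2 * s) ≠ 0 := Complex.Gammaℝ_ne_zero_of_re_pos (by simpa using hs)
    have hΛ : completedRiemannZeta (2 * s) = Complex.Gammaℝ (2 * s) * riemannZeta (2 * s) := by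
      rw [riemannZeta_def_of_ne_zero hs0, mul_div_cancel₀ _ hG]
    rw [hΛ, Complex.Gammaℝ_def, show -(2 * s) / 2 = -s by ring, show 2 * s / 2 = s by ring]
  refine (hr.congr_of_eventuallyEq heq).congr_deriv ?_
  have hlog : (Real.log (4 * π * v) : ℂ) =
      2 * (Real.log (2 * π) : ℂ) - (Real.log π : ℂ) + (Real.log v : ℂ) := by
    rw [Real.log_mul (by positivity) hv.ne', Real.log_mul (by norm_num) Real.pi_ne_zero,
      Real.log_mul (by norm_num) Real.pi_ne_zero, show (4 : ℝ) = 2 ^ 2 by norm_num, Real.log_pow]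
    push_cast
    ring
  simp only [Pi.mul_apply, id, hlog, deriv_riemannZeta_two, sub_self, Complex.cpow_zero, mul_one,
    Complex.cpow_neg_one, Complex.Gamma_one, riemannZeta_two, ← Complex.ofReal_log hv.le,
    ← Complex.ofReal_log Real.pi_pos.le]
  field_simp
  ring
end

section
/- For every real v > 0, the function a₂(s) = v^{−s}·( (1−s)·Λ₀(2s−1) − (1−s)/(2s−1) − 1/2 ) is differentiable at s = 1 and its derivative there equals a₂'(1) = (1/(2v))·( −γ + log(4πv) ), where γ is the Euler–Mascheroni constant. (a₂ is the analytic continuation through s = 1 of (1−s)·v^{−s}·Λ(2s−1).) -/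
open Real Complex

/-- The analytic continuation `a₂(s) = v^{−s}·((1−s)·Λ₀(2s−1) − (1−s)/(2s−1) − 1/2)` of
`(1−s)·v^{−s}·Λ(2s−1)` through `s = 1` is differentiable at `s = 1` with derivative
`a₂'(1) = (1/(2v))·(−γ + log(4πv))`. -/
theorem deriv_a2_at_one (v : ℝ) (hv : 0 < v) :
    HasDerivAt (fun s : ℂ => (v : ℂ) ^ (-s) *
        ((1 - s) * completedRiemannZeta₀ (2 * s - 1) - (1 - s) / (2 * s - 1) - 1 / 2))
      ((1 / (2 * (v : ℂ))) *
        (-(Real.eulerMascheroniConstant : ℂ) + (Real.log (4 * π * v) : ℂ))) 1 := by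
  have hv' : (v : ℂ) ≠ 0 := ofReal_ne_zero.mpr hv.ne'
  have hlin : HasDerivAt (fun s : ℂ => 2 * s - 1) 2 1 := by
    simpa using ((hasDerivAt_id (1 : ℂ)).const_mul 2).sub_const 1
  have hsub : HasDerivAt (fun s : ℂ => 1 - s) (-1) 1 := by
    simpa using (hasDerivAt_id (1 : ℂ)).const_sub 1
  have hpow := (hasDerivAt_neg' (1 : ℂ)).const_cpow (c := (v : ℂ)) (Or.inl hv')
  have hzeta : HasDerivAt (fun s : ℂ => completedRiemannZeta₀ (2 * s - 1))
      (deriv completedRiemannZeta₀ 1 * 2) 1 :=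
    (differentiable_completedZeta₀ 1).hasDerivAt.comp_of_eq 1 hlin (by norm_num)
  have hquot := hsub.fun_div hlin (by norm_num)
  have hlog : (Real.log (4 * π * v) : ℂ) = Complex.log (4 * π) + Complex.log v := by
    rw [Real.log_mul (by positivity) hv.ne', ofReal_add, ofReal_log (by positivity),
      ofReal_log hv.le]
    push_cast
    rfl
  refine (hpow.fun_mul (((hsub.fun_mul hzeta).fun_sub hquot).sub_const (1 / 2))).congr_deriv ?_
  have hone : (2 * 1 - 1 : ℂ) = 1 := by norm_num
  rw [hlog, hone, completedRiemannZeta₀_one, cpow_neg_one]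
  field_simp
  ring
end

section
/- Let v > 0 be real and n ≥ 1 an integer. Then the sum over all pairs (b,c) of nonzero integers with b·c = n of the integrals ∫₀^∞ ∫₁^∞ e^{−πv(b/s + cs)²·r} · r^{−3/2} dr · s^{−1} ds satisfies Σ_{(b,c): bc = n} ∫₀^∞ ∫₁^∞ e^{−πv(b/s+cs)²r} r^{−3/2} dr s^{−1} ds ≤ 2τ(n)·( (1/(2√(nv)))·e^{−4πnv} − 2π√(nv)·∫₁^∞ e^{−4πnvt}·t^{−1} dt ). (This is the bound Σ ∫₀^∞ B(v,s;b,c) ds/s ≤ 2τ(|m|)( (1/(2√(|m|v)))e^{−4π|m|v} + 2π√(|m|v)·Ei(−4π|m|v) ) for m = −bc = −n < 0, where Ei(−x) = −∫₁^∞ e^{−xt} t^{−1} dt.) -/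
open Real MeasureTheory Set

theorem one_add_sq_le_cosh_sq (u : ℝ) : 1 + u ^ 2 ≤ Real.cosh u ^ 2 := by
  rw [Real.cosh_sq']
  have h : |u| ≤ |Real.sinh u| := by
    rw [Real.abs_sinh]
    exact Real.self_le_sinh_iff.2 (abs_nonneg u)
  have := sq_le_sq.2 h
  linarith

/-- After the substitution `s = √(b/c)·eᵘ` the square `(b/s + cs)²` is `4bc·cosh² u`. -/
theorem four_mul_le_sq_div_add_mul {b c : ℝ} (h : 0 < b * c) (u : ℝ) :
    4 * (b * c) * (1 + u ^ 2) ≤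
      (b / (√(b / c) * Real.exp u) + c * (√(b / c) * Real.exp u)) ^ 2 := by
  have hc : c ≠ 0 := right_ne_zero_of_mul h.ne'
  have hbc : 0 < b / c := by
    rw [← mul_div_mul_right b c hc]
    exact div_pos h (mul_self_pos.2 hc)
  have hk : 0 < √(b / c) := Real.sqrt_pos.2 hbc
  have hk2 : √(b / c) ^ 2 = b / c := Real.sq_sqrt hbc.le
  set k := √(b / c)
  have hb' : b = k ^ 2 * c := by rw [hk2]; field_simp
  have key : (b / (k * Real.exp u) + c * (k * Real.exp u)) ^ 2 =
      4 * (b * c) * Real.cosh u ^ 2 := by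
    rw [Real.cosh_eq, Real.exp_neg, hb']
    have := Real.exp_pos u
    field_simp
    ring
  rw [key]
  exact mul_le_mul_of_nonneg_left (one_add_sq_le_cosh_sq u) (by positivity)

theorem lintegral_exp_neg_sq_mul_inv_le {b c t : ℝ} (h : 0 < b * c) (ht : 0 < t) :
    ∫⁻ s in Ioi (0 : ℝ), ENNReal.ofReal (Real.exp (-(t * (b / s + c * s) ^ 2)) * s⁻¹) ≤
      ENNReal.ofReal (Real.exp (-(4 * (b * c) * t)) * √(π / (4 * (b * c) * t))) := by
  have hc : c ≠ 0 := right_ne_zero_of_mul h.ne'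
  have hbc : 0 < b / c := by
    rw [← mul_div_mul_right b c hc]
    exact div_pos h (mul_self_pos.2 hc)
  have hk : 0 < √(b / c) := Real.sqrt_pos.2 hbc
  have himg : (fun u : ℝ => √(b / c) * Real.exp u) '' univ = Ioi 0 := by
    ext s
    simp only [image_univ, mem_range, mem_Ioi]
    constructor
    · rintro ⟨u, rfl⟩
      positivity
    · intro hs
      refine ⟨Real.log (s / √(b / c)), ?_⟩
      rw [Real.exp_log (by positivity)]
      field_simp
  rw [← himg, lintegral_image_eq_lintegral_abs_deriv_mul MeasurableSet.univ
    (fun u _ => ((Real.hasDerivAt_exp u).const_mul _).hasDerivWithinAt)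
    (fun x _ y _ hxy => Real.exp_injective (mul_left_cancel₀ hk.ne' hxy)),
    ← integral_gaussian, ← integral_const_mul, Measure.restrict_univ,
    ofReal_integral_eq_lintegral_ofReal
      ((integrable_exp_neg_mul_sq (by positivity)).const_mul _)
      (Filter.Eventually.of_forall fun u => by positivity)]
  refine lintegral_mono fun u => ?_
  have hpos : 0 < √(b / c) * Real.exp u := by positivity
  rw [← ENNReal.ofReal_mul (abs_nonneg _), abs_of_pos hpos]
  apply ENNReal.ofReal_le_ofReal
  rw [mul_comm, mul_assoc, inv_mul_cancel₀ hpos.ne', mul_one, ← Real.exp_add]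
  apply Real.exp_le_exp.2
  have := mul_le_mul_of_nonneg_left (four_mul_le_sq_div_add_mul h u) ht.le
  linarith

theorem integrableOn_exp_neg_mul_mul_of_le_one {a : ℝ} (ha : 0 < a) {g : ℝ → ℝ}
    (hg : Measurable g) (hb : ∀ t ∈ Ioi (1 : ℝ), |g t| ≤ 1) :
    IntegrableOn (fun t => Real.exp (-(a * t)) * g t) (Ioi 1) := by
  have he : IntegrableOn (fun t => Real.exp (-(a * t))) (Ioi 1) := by
    simpa only [neg_mul] using exp_neg_integrableOn_Ioi 1 ha
  refine Integrable.mono he (by fun_prop) ?_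
  refine (ae_restrict_iff' measurableSet_Ioi).2 (Filter.Eventually.of_forall fun t ht => ?_)
  rw [norm_mul]
  exact mul_le_of_le_one_right (norm_nonneg _) (hb t ht)

theorem integrableOn_exp_neg_mul_inv {a : ℝ} (ha : 0 < a) :
    IntegrableOn (fun t : ℝ => Real.exp (-(a * t)) * t⁻¹) (Ioi 1) := by
  refine integrableOn_exp_neg_mul_mul_of_le_one ha measurable_inv fun t ht => ?_
  have ht' : (1 : ℝ) < t := ht
  rw [abs_of_pos (by positivity)]
  exact inv_le_one_of_one_le₀ ht'.le

theorem integrableOn_exp_neg_mul_inv_sq {a : ℝ} (ha : 0 < a) :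
    IntegrableOn (fun t : ℝ => Real.exp (-(a * t)) * (t ^ 2)⁻¹) (Ioi 1) := by
  refine integrableOn_exp_neg_mul_mul_of_le_one ha (by fun_prop) fun t ht => ?_
  have ht' : (1 : ℝ) < t := ht
  rw [abs_of_pos (by positivity)]
  exact inv_le_one_of_one_le₀ (one_le_pow₀ ht'.le)

theorem integral_exp_neg_mul_inv_sq {a : ℝ} (ha : 0 < a) :
    ∫ t in Ioi (1 : ℝ), Real.exp (-(a * t)) * (t ^ 2)⁻¹ =
      Real.exp (-a) - a * ∫ t in Ioi (1 : ℝ), Real.exp (-(a * t)) * t⁻¹ := by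
  have h1 := (integrableOn_exp_neg_mul_inv ha).const_mul a
  have h2 := integrableOn_exp_neg_mul_inv_sq ha
  have hd : ∀ t ∈ Ici (1 : ℝ), HasDerivAt (fun t => -(Real.exp (-(a * t)) * t⁻¹))
      (a * (Real.exp (-(a * t)) * t⁻¹) + Real.exp (-(a * t)) * (t ^ 2)⁻¹) t := by
    intro t ht
    have ht0 : t ≠ 0 := (lt_of_lt_of_le one_pos ht).ne'
    have := ((((hasDerivAt_id t).const_mul a).neg.exp).mul (hasDerivAt_inv ht0)).neg
    refine this.congr_deriv ?_
    simp only [id, mul_one, Pi.neg_apply]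
    ring
  have hlim : Filter.Tendsto (fun t : ℝ => -(Real.exp (-(a * t)) * t⁻¹)) Filter.atTop (nhds 0) := by
    have he : Filter.Tendsto (fun t : ℝ => Real.exp (-(a * t))) Filter.atTop (nhds 0) :=
      Real.tendsto_exp_neg_atTop_nhds_zero.comp (Filter.tendsto_id.const_mul_atTop ha)
    simpa using (he.mul tendsto_inv_atTop_zero).neg
  have := integral_Ioi_of_hasDerivAt_of_tendsto' hd (h1.add h2) hlim
  rw [integral_add h1 h2, integral_const_mul] at this
  simp only [mul_one, inv_one] at this
  linarith

theorem integral_exp_neg_sq_le {v b c : ℝ} (hv : 0 < v) (h : 0 < b * c) :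
    ∫ s in Ioi (0 : ℝ), (∫ r in Ioi (1 : ℝ),
        Real.exp (-(π * v * (b / s + c * s) ^ 2 * r)) * r ^ (-(3 / 2) : ℝ)) * s⁻¹ ≤
      1 / (2 * √(b * c * v)) *
        ∫ r in Ioi (1 : ℝ), Real.exp (-(4 * π * (b * c) * v * r)) * (r ^ 2)⁻¹ := by
  have ha : 0 < 4 * π * (b * c) * v := by positivity
  have hnn : 0 ≤ ∫ r in Ioi (1 : ℝ), Real.exp (-(4 * π * (b * c) * v * r)) * (r ^ 2)⁻¹ :=
    integral_nonneg fun r => by positivity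
  rw [← ENNReal.ofReal_le_ofReal_iff (by positivity), ← integral_const_mul]
  calc ENNReal.ofReal _ ≤ _ := Real.ofReal_le_enorm _
    _ ≤ _ := enorm_integral_le_lintegral_enorm _
    _ ≤ ∫⁻ s in Ioi (0 : ℝ), ∫⁻ r in Ioi (1 : ℝ), ENNReal.ofReal (r ^ (-(3 / 2) : ℝ)) *
          ENNReal.ofReal (Real.exp (-(π * v * r * (b / s + c * s) ^ 2)) * s⁻¹) := by
        refine setLIntegral_mono' measurableSet_Ioi fun s hs => ?_
        have hs' : (0 : ℝ) < s := hs
        rw [← integral_mul_const]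
        refine (enorm_integral_le_lintegral_enorm _).trans ?_
        refine setLIntegral_mono' measurableSet_Ioi fun r hr => ?_
        have hr' : (0 : ℝ) < r := one_pos.trans hr
        rw [Real.enorm_of_nonneg (by positivity), ← ENNReal.ofReal_mul (by positivity)]
        apply ENNReal.ofReal_le_ofReal
        rw [mul_right_comm (π * v) _ r]
        exact le_of_eq (by ring)
    _ = ∫⁻ r in Ioi (1 : ℝ), ∫⁻ s in Ioi (0 : ℝ), ENNReal.ofReal (r ^ (-(3 / 2) : ℝ)) *
          ENNReal.ofReal (Real.exp (-(π * v * r * (b / s + c * s) ^ 2)) * s⁻¹) :=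
        lintegral_lintegral_swap (by unfold Function.uncurry; fun_prop)
    _ ≤ ∫⁻ r in Ioi (1 : ℝ), ENNReal.ofReal (1 / (2 * √(b * c * v)) *
          (Real.exp (-(4 * π * (b * c) * v * r)) * (r ^ 2)⁻¹)) := by
        refine setLIntegral_mono' measurableSet_Ioi fun r hr => ?_
        have hr' : (0 : ℝ) < r := one_pos.trans hr
        rw [lintegral_const_mul _ (by fun_prop)]
        refine (mul_le_mul_right (lintegral_exp_neg_sq_mul_inv_le h
          (by positivity : 0 < π * v * r)) _).trans ?_
        rw [← ENNReal.ofReal_mul (by positivity)]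
        apply ENNReal.ofReal_le_ofReal
        have hsqrt : √(π / (4 * (b * c) * (π * v * r))) = 1 / (2 * √(b * c * v)) * r ^ (-(1 / 2) : ℝ) := by
          rw [show π / (4 * (b * c) * (π * v * r)) = (2 ^ 2 * (b * c * v) * r)⁻¹ by
            field_simp; norm_num, Real.sqrt_inv, Real.sqrt_mul (by positivity),
            Real.sqrt_mul (by positivity), Real.sqrt_sq (by norm_num), Real.rpow_neg hr'.le,
            ← Real.sqrt_eq_rpow, mul_inv, one_div]
        have hpow : r ^ (-(3 / 2) : ℝ) * r ^ (-(1 / 2) : ℝ) = (r ^ 2)⁻¹ := by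
          rw [← Real.rpow_add hr', ← Real.rpow_natCast, ← Real.rpow_neg hr'.le]
          norm_num
        rw [hsqrt, ← hpow, show 4 * (b * c) * (π * v * r) = 4 * π * (b * c) * v * r by ring]
        exact le_of_eq (by ring)
    _ = _ := by
        rw [ofReal_integral_eq_lintegral_ofReal]
        · exact (integrableOn_exp_neg_mul_inv_sq ha).const_mul _
        · exact Filter.Eventually.of_forall fun r => by positivity

/-- A factorization of `n` is determined by the absolute value and the sign of its first factor. -/
theorem exists_injective_factorizations {n : ℕ} (hn : n ≠ 0) :
    ∃ f : {p : ℤ × ℤ // p.1 ≠ 0 ∧ p.2 ≠ 0 ∧ p.1 * p.2 = (n : ℤ)} → n.divisors × Bool,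
      Function.Injective f := by
  refine ⟨fun p => (⟨p.1.1.natAbs, Nat.mem_divisors.2
    ⟨Int.natAbs_dvd_natAbs.2 (Dvd.intro _ p.2.2.2 : p.1.1 ∣ (n : ℤ)), hn⟩⟩, decide (0 < p.1.1)), ?_⟩
  rintro ⟨⟨b, c⟩, hb, hc, h⟩ ⟨⟨b', c'⟩, hb', hc', h'⟩ heq
  simp only [Prod.mk.injEq, Subtype.mk.injEq, decide_eq_decide] at heq hb hb' h h' ⊢
  obtain rfl : b = b' := by omega
  exact ⟨rfl, mul_left_cancel₀ hb (h.trans h'.symm)⟩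

theorem tsum_factorizations_le {n : ℕ} (hn : n ≠ 0) {C : ℝ} (hC : 0 ≤ C)
    {f : {p : ℤ × ℤ // p.1 ≠ 0 ∧ p.2 ≠ 0 ∧ p.1 * p.2 = (n : ℤ)} → ℝ} (hf : ∀ p, f p ≤ C) :
    ∑' p, f p ≤ 2 * (n.divisors.card : ℝ) * C := by
  obtain ⟨g, hg⟩ := exists_injective_factorizations hn
  have := Fintype.ofInjective g hg
  rw [tsum_fintype]
  refine (Finset.sum_le_card_nsmul _ _ C fun p _ => hf p).trans ?_
  rw [nsmul_eq_mul]
  refine mul_le_mul_of_nonneg_right ?_ hC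
  have hcard := Fintype.card_le_of_injective g hg
  rw [Fintype.card_prod, Fintype.card_bool, Fintype.card_coe] at hcard
  rw [Finset.card_univ, mul_comm]
  exact_mod_cast hcard

/-- Bound for the boundary integrals at negative index `m = −bc = −n < 0`:
`Σ_{bc=n} ∫₀^∞ B(v,s;b,c) ds/s
   ≤ 2τ(n)·( (1/(2√(nv)))·e^{−4πnv} − 2π√(nv)·∫₁^∞ e^{−4πnvt}/t dt )`. -/
theorem boundary_B_integral_bound_neg (v : ℝ) (hv : 0 < v) (n : ℕ) (hn : 1 ≤ n) :
    (∑' p : {p : ℤ × ℤ // p.1 ≠ 0 ∧ p.2 ≠ 0 ∧ p.1 * p.2 = (n : ℤ)},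
        ∫ s in Ioi (0 : ℝ),
          (∫ r in Ioi (1 : ℝ),
            Real.exp (-(π * v * ((p.1.1 : ℝ) / s + (p.1.2 : ℝ) * s) ^ 2 * r)) *
              r ^ (-(3 / 2) : ℝ)) * s⁻¹) ≤
      2 * (n.divisors.card : ℝ) *
        (1 / (2 * Real.sqrt (n * v)) * Real.exp (-(4 * π * n * v)) -
          2 * π * Real.sqrt (n * v) *
            ∫ t in Ioi (1 : ℝ), Real.exp (-(4 * π * n * v * t)) * t⁻¹) := by
  have hnv : 0 < (n : ℝ) * v := mul_pos (Nat.cast_pos.2 hn) hv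
  have hC : 1 / (2 * √(n * v)) *
        ∫ r in Ioi (1 : ℝ), Real.exp (-(4 * π * n * v * r)) * (r ^ 2)⁻¹ =
      1 / (2 * √(n * v)) * Real.exp (-(4 * π * n * v)) - 2 * π * √(n * v) *
        ∫ t in Ioi (1 : ℝ), Real.exp (-(4 * π * n * v * t)) * t⁻¹ := by
    rw [integral_exp_neg_mul_inv_sq (by rw [mul_assoc]; positivity)]
    have hs : 0 < √(n * v) := Real.sqrt_pos.2 hnv
    have hcoef : 1 / (2 * √(n * v)) * (4 * π * n * v) = 2 * π * √(n * v) := by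
      rw [mul_assoc (4 * π), ← Real.mul_self_sqrt hnv.le, Real.sqrt_mul_self hs.le]
      field_simp
      norm_num
    rw [mul_sub, ← mul_assoc, hcoef]
  rw [← hC]
  refine tsum_factorizations_le (by omega)
    (mul_nonneg (by positivity) (integral_nonneg fun r => by positivity)) ?_
  rintro ⟨⟨b, c⟩, -, -, h⟩
  have h' : (b : ℝ) * c = n := by exact_mod_cast h
  have := integral_exp_neg_sq_le (b := b) (c := c) hv
    (by rw [h']; exact Nat.cast_pos.2 hn)
  rwa [h'] at this
end

section
/- Let v > 0 be real and n ≥ 1 an integer. Then the sum over all pairs (b,c) of nonzero integers with b·c = −n of the integrals ∫₀^∞ ∫₁^∞ e^{−πv(b/s + cs)²·r} · r^{−3/2} dr · s^{−1} ds satisfies Σ_{(b,c): bc = −n} ∫₀^∞ ∫₁^∞ e^{−πv(b/s+cs)²r} r^{−3/2} dr s^{−1} ds ≤ 2τ(n)·(1/(2√(nv))) = τ(n)/√(nv). (This is the bound Σ_{−bc=m} ∫₀^∞ B(v,s;b,c) ds/s ≤ 2τ(m)/(2√(mv)) for m = −bc = n > 0.) -/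
open Real MeasureTheory Set

lemma Real.sq_le_sinh_sq (t : ℝ) : t ^ 2 ≤ Real.sinh t ^ 2 := by
  rw [sq_le_sq, Real.abs_sinh]
  exact Real.self_le_sinh_iff.2 (abs_nonneg t)

/-- Integration against `ds/s` on the half-line in the coordinate `s = a * exp t`. -/
lemma integral_Ioi_mul_inv_eq_integral_comp_mul_exp (F : ℝ → ℝ) {a : ℝ} (ha : 0 < a) :
    ∫ s in Ioi (0 : ℝ), F s * s⁻¹ = ∫ t : ℝ, F (a * Real.exp t) := by
  have himg : (fun t : ℝ => a * Real.exp t) '' univ = Ioi 0 := by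
    ext s
    simp only [image_univ, mem_range, mem_Ioi]
    constructor
    · rintro ⟨t, rfl⟩
      positivity
    · intro hs
      refine ⟨Real.log (s / a), ?_⟩
      rw [Real.exp_log (by positivity)]
      field_simp
  have h := integral_image_eq_integral_abs_deriv_smul (s := univ)
    (f := fun t : ℝ => a * Real.exp t) (f' := fun t : ℝ => a * Real.exp t) MeasurableSet.univ
    (fun t _ => ((Real.hasDerivAt_exp t).const_mul a).hasDerivWithinAt)
    (fun x _ y _ hxy => Real.exp_injective (mul_left_cancel₀ ha.ne' hxy))
    (fun s => F s * s⁻¹)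
  rw [himg, Measure.restrict_univ] at h
  rw [h]
  congr 1
  ext t
  have hpos : 0 < a * Real.exp t := by positivity
  rw [abs_of_pos hpos, smul_eq_mul]
  field_simp

lemma sqrt_pi_div_mul_rpow {K r : ℝ} (hr : 0 < r) :
    √(π / (K * r)) * r ^ (-(3 / 2) : ℝ) = √(π / K) * r ^ (-2 : ℝ) := by
  rw [← div_div, div_eq_mul_inv _ r, Real.sqrt_mul' _ (by positivity), mul_assoc]
  congr 1
  rw [Real.sqrt_eq_rpow, ← Real.rpow_neg_one, ← Real.rpow_mul hr.le, ← Real.rpow_add hr]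
  norm_num

lemma integrable_exp_neg_mul_sq_mul_rpow_prod {K : ℝ} (hK : 0 < K) :
    Integrable (fun p : ℝ × ℝ => Real.exp (-(K * p.1 ^ 2 * p.2)) * p.2 ^ (-(3 / 2) : ℝ))
      (volume.prod (volume.restrict (Ioi (1 : ℝ)))) := by
  have hmeas : Measurable
      (fun p : ℝ × ℝ => Real.exp (-(K * p.1 ^ 2 * p.2)) * p.2 ^ (-(3 / 2) : ℝ)) := by
    fun_prop
  rw [integrable_prod_iff' hmeas.aestronglyMeasurable]
  constructor
  · filter_upwards [ae_restrict_mem measurableSet_Ioi] with r hr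
    have hr0 : (0 : ℝ) < r := zero_lt_one.trans hr
    refine ((integrable_exp_neg_mul_sq (mul_pos hK hr0)).mul_const
      (r ^ (-(3 / 2) : ℝ))).congr ?_
    filter_upwards with x
    ring_nf
  · have h2 : IntegrableOn (fun r : ℝ => √(π / K) * r ^ (-2 : ℝ)) (Ioi 1) :=
      (integrableOn_Ioi_rpow_of_lt (by norm_num) zero_lt_one).const_mul _
    refine h2.congr ?_
    filter_upwards [ae_restrict_mem measurableSet_Ioi] with r hr
    have hr0 : (0 : ℝ) < r := zero_lt_one.trans hr
    rw [← sqrt_pi_div_mul_rpow hr0, ← integral_gaussian, ← integral_mul_const]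
    congr 1
    ext x
    rw [Real.norm_of_nonneg (by positivity)]
    ring_nf

lemma integral_integral_exp_neg_mul_sq_mul_rpow {K : ℝ} (hK : 0 < K) :
    ∫ t : ℝ, ∫ r in Ioi (1 : ℝ), Real.exp (-(K * t ^ 2 * r)) * r ^ (-(3 / 2) : ℝ) =
      √(π / K) := by
  rw [integral_integral_swap (integrable_exp_neg_mul_sq_mul_rpow_prod hK)]
  have h : ∀ r ∈ Ioi (1 : ℝ), ∫ t : ℝ, Real.exp (-(K * t ^ 2 * r)) * r ^ (-(3 / 2) : ℝ) =
      √(π / K) * r ^ (-2 : ℝ) := by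
    intro r hr
    rw [← sqrt_pi_div_mul_rpow (zero_lt_one.trans hr), ← integral_gaussian, ← integral_mul_const]
    congr 1
    ext x
    ring_nf
  rw [setIntegral_congr_fun measurableSet_Ioi h, integral_const_mul,
    integral_Ioi_rpow_of_lt (by norm_num) zero_lt_one]
  norm_num

lemma integrableOn_exp_neg_mul_mul_rpow {A : ℝ} (hA : 0 ≤ A) :
    IntegrableOn (fun r : ℝ => Real.exp (-(A * r)) * r ^ (-(3 / 2) : ℝ)) (Ioi 1) := by
  have h : IntegrableOn (fun r : ℝ => r ^ (-(3 / 2) : ℝ)) (Ioi 1) :=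
    integrableOn_Ioi_rpow_of_lt (by norm_num) zero_lt_one
  refine Integrable.mono' h (by fun_prop) ?_
  filter_upwards [ae_restrict_mem measurableSet_Ioi] with r hr
  have hr0 : (0 : ℝ) < r := zero_lt_one.trans hr
  rw [Real.norm_of_nonneg (by positivity)]
  refine mul_le_of_le_one_left (by positivity) (Real.exp_le_one_iff.2 ?_)
  have := mul_nonneg hA hr0.le
  linarith

lemma integral_exp_neg_mul_rpow_le_of_le {A B : ℝ} (hA : 0 ≤ A) (hAB : A ≤ B) :
    ∫ r in Ioi (1 : ℝ), Real.exp (-(B * r)) * r ^ (-(3 / 2) : ℝ) ≤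
      ∫ r in Ioi (1 : ℝ), Real.exp (-(A * r)) * r ^ (-(3 / 2) : ℝ) := by
  refine setIntegral_mono_on (integrableOn_exp_neg_mul_mul_rpow (hA.trans hAB))
    (integrableOn_exp_neg_mul_mul_rpow hA) measurableSet_Ioi fun r hr => ?_
  have hr0 : (0 : ℝ) < r := zero_lt_one.trans hr
  gcongr

lemma div_add_mul_sq_eq_sinh_sq {b c N : ℝ} (hc : c ≠ 0) (hN : 0 < N) (h : b * c = -N) (t : ℝ) :
    (b / (√N / |c| * Real.exp t) + c * (√N / |c| * Real.exp t)) ^ 2 =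
      4 * N * Real.sinh t ^ 2 := by
  have hb : b = -N / c := by field_simp; exact h
  have hsq : √N ^ 2 = N := Real.sq_sqrt hN.le
  have hs : √N ≠ 0 := (Real.sqrt_pos.2 hN).ne'
  have hc' : |c| ≠ 0 := abs_ne_zero.2 hc
  have hE := Real.exp_ne_zero t
  rw [Real.sinh_eq, Real.exp_neg, hb]
  generalize √N = q at *
  subst hsq
  field_simp
  rw [sq_abs]
  ring

lemma integral_boundary_B_le {v : ℝ} (hv : 0 < v) {b c N : ℝ} (hc : c ≠ 0) (hN : 0 < N)
    (h : b * c = -N) :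
    ∫ s in Ioi (0 : ℝ), (∫ r in Ioi (1 : ℝ),
      Real.exp (-(π * v * (b / s + c * s) ^ 2 * r)) * r ^ (-(3 / 2) : ℝ)) * s⁻¹ ≤
      1 / (2 * √(N * v)) := by
  have ha : 0 < √N / |c| := div_pos (Real.sqrt_pos.2 hN) (abs_pos.2 hc)
  have hK : 0 < 4 * π * v * N := by positivity
  rw [integral_Ioi_mul_inv_eq_integral_comp_mul_exp (fun s => ∫ r in Ioi (1 : ℝ),
      Real.exp (-(π * v * (b / s + c * s) ^ 2 * r)) * r ^ (-(3 / 2) : ℝ)) ha]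
  have hval : √(π / (4 * π * v * N)) = 1 / (2 * √(N * v)) := by
    have h4 : π / (4 * π * v * N) = (1 / (2 * √(N * v))) ^ 2 := by
      rw [div_pow, mul_pow, Real.sq_sqrt (by positivity)]
      field_simp
      norm_num
    rw [h4, Real.sqrt_sq (by positivity)]
  rw [← hval, ← integral_integral_exp_neg_mul_sq_mul_rpow hK]
  refine integral_mono_of_nonneg (Filter.Eventually.of_forall fun t => ?_)
    (integrable_exp_neg_mul_sq_mul_rpow_prod hK).integral_prod_left
    (Filter.Eventually.of_forall fun t => ?_)
  · refine setIntegral_nonneg measurableSet_Ioi fun r hr => ?_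
    have hr0 : (0 : ℝ) < r := zero_lt_one.trans hr
    positivity
  · refine integral_exp_neg_mul_rpow_le_of_le (by positivity) ?_
    rw [div_add_mul_sq_eq_sinh_sq hc hN h]
    have := mul_le_mul_of_nonneg_left (Real.sq_le_sinh_sq t) hK.le
    linarith

/-- A factorization `b * c = -n` is determined by the divisor `|b|` and the sign of `b`. -/
def factorizationNegToDivisorsProdBool (n : ℕ) (hn : 1 ≤ n)
    (p : {p : ℤ × ℤ // p.1 ≠ 0 ∧ p.2 ≠ 0 ∧ p.1 * p.2 = -(n : ℤ)}) : n.divisors × Bool :=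
  (⟨p.1.1.natAbs, Nat.mem_divisors.2
    ⟨Int.natCast_dvd_natCast.1 (Int.natAbs_dvd.2 (dvd_neg.1 ⟨p.1.2, p.2.2.2.symm⟩)), by omega⟩⟩,
    decide (0 < p.1.1))

lemma factorizationNegToDivisorsProdBool_injective (n : ℕ) (hn : 1 ≤ n) :
    Function.Injective (factorizationNegToDivisorsProdBool n hn) := by
  rintro ⟨⟨b, c⟩, hb, hc, h⟩ ⟨⟨b', c'⟩, hb', hc', h'⟩ heq
  simp only [factorizationNegToDivisorsProdBool, Prod.mk.injEq, Subtype.mk.injEq,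
    decide_eq_decide] at heq
  dsimp only at hb hb' h h'
  obtain rfl : b = b' := by omega
  obtain rfl : c = c' := mul_left_cancel₀ hb (h.trans h'.symm)
  rfl

/-- Bound for the boundary integrals at positive index `m = −bc = n > 0`:
`Σ_{bc=−n} ∫₀^∞ B(v,s;b,c) ds/s ≤ 2τ(n)·(1/(2√(nv)))`. -/
theorem boundary_B_integral_bound_pos (v : ℝ) (hv : 0 < v) (n : ℕ) (hn : 1 ≤ n) :
    (∑' p : {p : ℤ × ℤ // p.1 ≠ 0 ∧ p.2 ≠ 0 ∧ p.1 * p.2 = -(n : ℤ)},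
        ∫ s in Ioi (0 : ℝ),
          (∫ r in Ioi (1 : ℝ),
            Real.exp (-(π * v * ((p.1.1 : ℝ) / s + (p.1.2 : ℝ) * s) ^ 2 * r)) *
              r ^ (-(3 / 2) : ℝ)) * s⁻¹) ≤
      2 * (n.divisors.card : ℝ) * (1 / (2 * Real.sqrt (n * v))) := by
  have hinj := factorizationNegToDivisorsProdBool_injective n hn
  have : Finite {p : ℤ × ℤ // p.1 ≠ 0 ∧ p.2 ≠ 0 ∧ p.1 * p.2 = -(n : ℤ)} :=
    Finite.of_injective _ hinj
  have := Fintype.ofFinite {p : ℤ × ℤ // p.1 ≠ 0 ∧ p.2 ≠ 0 ∧ p.1 * p.2 = -(n : ℤ)}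
  have hcard := Fintype.card_le_of_injective _ hinj
  rw [Fintype.card_prod, Fintype.card_coe, Fintype.card_bool, mul_comm] at hcard
  rw [tsum_fintype]
  refine (Finset.sum_le_card_nsmul _ _ (1 / (2 * √(n * v))) fun p _ => ?_).trans ?_
  · exact integral_boundary_B_le hv (Int.cast_ne_zero.2 p.2.2.1) (Nat.cast_pos.2 hn)
      (by exact_mod_cast p.2.2.2)
  · rw [nsmul_eq_mul, Finset.card_univ]
    gcongr
    exact_mod_cast hcard
end

section
/- For every real β > 0 one has ∫₀^∞ ∫_{−∞}^{∞} ∫₁^∞ e^{−πβ·((1−y)² + x²)·u/y} · u^{−1} du dx · y^{−2} dy = 1/β. That is, the integral over the upper half plane ℍ (with hyperbolic measure dμ(z) = dx dy/y²) of the inner integral ∫₁^∞ e^{−πβ(1/y)((1−y)²+x²)u} du/u equals 1/β. -/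
open Real MeasureTheory Set

/-- The Gaussian integral in `ℝ≥0∞`. -/
lemma lintegral_gaussian {b : ℝ} (hb : 0 < b) :
    ∫⁻ x : ℝ, ENNReal.ofReal (exp (-b * x ^ 2)) = ENNReal.ofReal (√(π / b)) := by
  rw [← integral_gaussian, ofReal_integral_eq_lintegral_ofReal (integrable_exp_neg_mul_sq hb)
    (Filter.Eventually.of_forall fun x => (exp_pos _).le)]

/-- Logarithmic change of variables on the half line. -/
lemma lintegral_Ioi_zero_eq_lintegral_exp (f : ℝ → ENNReal) :
    ∫⁻ y in Ioi (0 : ℝ), f y = ∫⁻ t : ℝ, ENNReal.ofReal (exp t) * f (exp t) := by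
  have h := lintegral_image_eq_lintegral_abs_deriv_mul (s := univ) MeasurableSet.univ
    (fun t _ => (Real.hasDerivAt_exp t).hasDerivWithinAt) exp_injective.injOn f
  simpa [image_univ, range_exp, abs_of_pos (exp_pos _)] using h

/-- Substitution `w = 2 sinh (t / 2)` in the Gaussian integral. -/
lemma lintegral_cosh_mul_exp_neg_sinh_sq {a : ℝ} (ha : 0 < a) :
    ∫⁻ t : ℝ, ENNReal.ofReal (cosh (t / 2) * exp (-a * (2 * sinh (t / 2)) ^ 2)) =
      ENNReal.ofReal (√(π / a)) := by
  have hd : ∀ t ∈ (univ : Set ℝ),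
      HasDerivWithinAt (fun t : ℝ => 2 * sinh (t / 2)) (cosh (t / 2)) univ t := fun t _ => by
    have h := (((hasDerivAt_id' t).div_const 2).sinh.const_mul 2).hasDerivWithinAt (s := univ)
    exact h.congr_deriv (by ring)
  have hi : InjOn (fun t : ℝ => 2 * sinh (t / 2)) univ := fun s _ t _ h => by
    have h' := sinh_injective (mul_left_cancel₀ two_ne_zero h)
    linarith
  have hs : (fun t : ℝ => 2 * sinh (t / 2)) '' univ = univ := by
    rw [image_univ, range_eq_univ]
    intro w
    exact ⟨2 * arsinh (w / 2), by simp [mul_div_cancel₀]⟩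
  have h := lintegral_image_eq_lintegral_abs_deriv_mul MeasurableSet.univ hd hi
    (fun w => ENNReal.ofReal (exp (-a * w ^ 2)))
  rw [hs, Measure.restrict_univ, lintegral_gaussian ha] at h
  rw [h]
  refine lintegral_congr fun t => ?_
  rw [abs_of_pos (cosh_pos _), ENNReal.ofReal_mul (cosh_pos _).le]

/-- Normalization of the inverse Gaussian density, in logarithmic coordinates. -/
lemma lintegral_exp_neg_half_mul_exp_neg_sinh_sq {a : ℝ} (ha : 0 < a) :
    ∫⁻ t : ℝ, ENNReal.ofReal (exp (-(t / 2)) * exp (-a * (2 * sinh (t / 2)) ^ 2)) =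
      ENNReal.ofReal (√(π / a)) := by
  set J := ∫⁻ t : ℝ, ENNReal.ofReal (exp (-(t / 2)) * exp (-a * (2 * sinh (t / 2)) ^ 2)) with hJ
  have hneg : J = ∫⁻ t : ℝ, ENNReal.ofReal (exp (t / 2) * exp (-a * (2 * sinh (t / 2)) ^ 2)) := by
    rw [hJ, ← (Measure.measurePreserving_neg (volume : Measure ℝ)).lintegral_comp (by fun_prop)]
    simp [neg_div, sinh_neg]
  have h2 : 2 * J = 2 * ENNReal.ofReal (√(π / a)) := by
    rw [two_mul]
    nth_rw 2 [hneg]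
    rw [hJ, ← lintegral_add_left (by fun_prop), ← lintegral_cosh_mul_exp_neg_sinh_sq ha,
      ← lintegral_const_mul _ (by fun_prop)]
    refine lintegral_congr fun t => ?_
    rw [← ENNReal.ofReal_add (by positivity) (by positivity),
      ← ENNReal.ofReal_ofNat, ← ENNReal.ofReal_mul (by norm_num), cosh_eq]
    congr 1
    ring
  exact (ENNReal.mul_right_inj two_ne_zero ENNReal.ofNat_ne_top).mp h2

/-- The integral of the Gaussian `e^{-a ((1 - y)² + x²) / y}` over a horocycle. -/
lemma lintegral_horocycle {a y : ℝ} (ha : 0 < a) (hy : 0 < y) :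
    ∫⁻ x : ℝ, ENNReal.ofReal (exp (-(a * ((1 - y) ^ 2 + x ^ 2) / y))) =
      ENNReal.ofReal (exp (-(a * (1 - y) ^ 2 / y)) * √(π / (a / y))) := by
  rw [ENNReal.ofReal_mul (exp_pos _).le, ← lintegral_gaussian (div_pos ha hy),
    ← lintegral_const_mul _ (by fun_prop)]
  refine lintegral_congr fun x => ?_
  rw [← ENNReal.ofReal_mul (exp_pos _).le, ← exp_add]
  congr 2
  ring

/-- The integral of `e^{-a ((1 - y)² + x²) / y}` over the hyperbolic plane. -/
lemma lintegral_halfPlane {a : ℝ} (ha : 0 < a) :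
    ∫⁻ y in Ioi (0 : ℝ),
      (∫⁻ x : ℝ, ENNReal.ofReal (exp (-(a * ((1 - y) ^ 2 + x ^ 2) / y)))) *
        ENNReal.ofReal ((y ^ 2)⁻¹) = ENNReal.ofReal (π / a) := by
  rw [lintegral_Ioi_zero_eq_lintegral_exp]
  have hsq : π / a = √(π / a) * √(π / a) := (mul_self_sqrt (by positivity)).symm
  rw [hsq, ENNReal.ofReal_mul (sqrt_nonneg _)]
  nth_rw 2 [← lintegral_exp_neg_half_mul_exp_neg_sinh_sq ha]
  rw [← lintegral_const_mul _ (by fun_prop)]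
  refine lintegral_congr fun t => ?_
  rw [lintegral_horocycle ha (exp_pos t), ← ENNReal.ofReal_mul (by positivity),
    ← ENNReal.ofReal_mul (by positivity), ← ENNReal.ofReal_mul (by positivity)]
  congr 1
  have he : exp t = exp (t / 2) ^ 2 := by rw [← exp_nat_mul]; congr 1; push_cast; ring
  have hs : √(π / (a / exp t)) = √(π / a) * exp (t / 2) := by
    rw [show π / (a / exp t) = π / a * exp (t / 2) ^ 2 by rw [← he]; field_simp,
      sqrt_mul (by positivity), sqrt_sq (exp_pos _).le]
  have hE : -(a * (1 - exp t) ^ 2 / exp t) = -a * (2 * sinh (t / 2)) ^ 2 := by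
    rw [sinh_eq, exp_neg, he]
    field_simp
    ring
  rw [hs, hE, exp_neg, he]
  field_simp

/-- If an iterated lower Lebesgue integral is finite, it computes the iterated Bochner integral. -/
lemma integral_toReal_lintegral_mul {α γ : Type*} [MeasurableSpace α] [MeasurableSpace γ]
    {μ : Measure α} {ν : Measure γ} [SFinite ν] {G : α → γ → ENNReal}
    (hG : Measurable (Function.uncurry G)) {c : α → ℝ} (hc : Measurable c)
    (hpos : ∀ᵐ y ∂μ, 0 < c y)
    (hfin : ∫⁻ y, (∫⁻ x, G y x ∂ν) * ENNReal.ofReal (c y) ∂μ ≠ ⊤) :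
    ∫ y, (∫ x, (G y x).toReal ∂ν) * c y ∂μ =
      (∫⁻ y, (∫⁻ x, G y x ∂ν) * ENNReal.ofReal (c y) ∂μ).toReal := by
  have hm : Measurable fun y => (∫⁻ x, G y x ∂ν) * ENNReal.ofReal (c y) :=
    hG.lintegral_prod_right'.mul hc.ennreal_ofReal
  have hlt := ae_lt_top hm hfin
  rw [← integral_toReal hm.aemeasurable hlt]
  refine integral_congr_ae ?_
  filter_upwards [hpos, hlt] with y hy hy'
  have hGy : Measurable (G y) := hG.comp measurable_prodMk_left
  have hne : ∫⁻ x, G y x ∂ν ≠ ⊤ := fun h => by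
    rw [h, ENNReal.top_mul (by simpa using hy)] at hy'
    exact lt_irrefl _ hy'
  rw [integral_toReal hGy.aemeasurable (ae_lt_top hGy hne), ENNReal.toReal_mul,
    ENNReal.toReal_ofReal hy.le]

lemma lintegral_Ioi_one_inv_sq :
    ∫⁻ u in Ioi (1 : ℝ), ENNReal.ofReal ((u ^ 2)⁻¹) = 1 := by
  have hi := integrableOn_Ioi_rpow_of_lt (a := -2) (by norm_num) one_pos
  have h := integral_Ioi_rpow_of_lt (a := -2) (by norm_num) one_pos
  have he : EqOn (fun u : ℝ => u ^ (-2 : ℝ)) (fun u => (u ^ 2)⁻¹) (Ioi 1) := fun u hu => by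
    have : (0 : ℝ) ≤ u := zero_le_one.trans (le_of_lt hu)
    simp [rpow_neg this]
  rw [integrableOn_congr_fun he measurableSet_Ioi] at hi
  rw [setIntegral_congr_fun measurableSet_Ioi he] at h
  rw [← ofReal_integral_eq_lintegral_ofReal hi
    (Filter.Eventually.of_forall fun u => by positivity), h]
  norm_num

/-- The unfolded Green function integral as an iterated lower Lebesgue integral. -/
lemma lintegral_unfolded_green {β : ℝ} (hβ : 0 < β) :
    ∫⁻ y in Ioi (0 : ℝ), (∫⁻ x : ℝ, ∫⁻ u in Ioi (1 : ℝ),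
        ENNReal.ofReal (exp (-(π * β * ((1 - y) ^ 2 + x ^ 2) * u / y)) * u⁻¹)) *
          ENNReal.ofReal ((y ^ 2)⁻¹) = ENNReal.ofReal (1 / β) := by
  have hswap : ∀ y : ℝ, (∫⁻ x : ℝ, ∫⁻ u in Ioi (1 : ℝ),
        ENNReal.ofReal (exp (-(π * β * ((1 - y) ^ 2 + x ^ 2) * u / y)) * u⁻¹)) *
          ENNReal.ofReal ((y ^ 2)⁻¹) =
      ∫⁻ u in Ioi (1 : ℝ), (∫⁻ x : ℝ,
        ENNReal.ofReal (exp (-(π * β * ((1 - y) ^ 2 + x ^ 2) * u / y)) * u⁻¹)) *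
          ENNReal.ofReal ((y ^ 2)⁻¹) := fun y => by
    rw [lintegral_lintegral_swap (by fun_prop), lintegral_mul_const _]
    exact Measurable.lintegral_prod_right' (f := fun p : ℝ × ℝ =>
      ENNReal.ofReal (exp (-(π * β * ((1 - y) ^ 2 + p.2 ^ 2) * p.1 / y)) * p.1⁻¹)) (by fun_prop)
  simp_rw [hswap]
  rw [lintegral_lintegral_swap]
  · rw [show ENNReal.ofReal (1 / β) = ENNReal.ofReal (1 / β) *
      ∫⁻ u in Ioi (1 : ℝ), ENNReal.ofReal ((u ^ 2)⁻¹) by rw [lintegral_Ioi_one_inv_sq, mul_one],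
      ← lintegral_const_mul _ (by fun_prop)]
    refine setLIntegral_congr_fun measurableSet_Ioi fun u hu => ?_
    have hu0 : 0 < u := zero_lt_one.trans hu
    have hx : ∀ y : ℝ, (∫⁻ x : ℝ,
        ENNReal.ofReal (exp (-(π * β * ((1 - y) ^ 2 + x ^ 2) * u / y)) * u⁻¹)) *
          ENNReal.ofReal ((y ^ 2)⁻¹) = ENNReal.ofReal u⁻¹ * ((∫⁻ x : ℝ,
        ENNReal.ofReal (exp (-(π * β * u * ((1 - y) ^ 2 + x ^ 2) / y)))) *
          ENNReal.ofReal ((y ^ 2)⁻¹)) := fun y => by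
      rw [← mul_assoc, ← lintegral_const_mul _ (by fun_prop)]
      congr 1
      refine lintegral_congr fun x => ?_
      rw [← ENNReal.ofReal_mul (by positivity), mul_comm u⁻¹]
      congr 4
      ring
    simp_rw [hx]
    rw [lintegral_const_mul' _ _ ENNReal.ofReal_ne_top, lintegral_halfPlane (by positivity),
      ← ENNReal.ofReal_mul (by positivity), ← ENNReal.ofReal_mul (by positivity)]
    congr 1
    field_simp
  · refine Measurable.aemeasurable (Measurable.mul ?_ (by fun_prop))
    exact Measurable.lintegral_prod_right' (f := fun p : (ℝ × ℝ) × ℝ => ENNReal.ofReal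
      (exp (-(π * β * ((1 - p.1.1) ^ 2 + p.2 ^ 2) * p.1.2 / p.1.1)) * p.1.2⁻¹)) (by fun_prop)

/-- The unfolded Green function integral for positive index:
`∫_ℍ ∫₁^∞ e^{−πβ(1/y)((1−y)²+x²)u} du/u dμ(z) = 1/β` with `dμ(z) = dx dy/y²`. -/
theorem unfolded_green_integral_pos (β : ℝ) (hβ : 0 < β) :
    (∫ y in Ioi (0 : ℝ),
        (∫ x : ℝ, ∫ u in Ioi (1 : ℝ),
          Real.exp (-(π * β * ((1 - y) ^ 2 + x ^ 2) * u / y)) * u⁻¹) * (y ^ 2)⁻¹) =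
      1 / β := by
  have hu : ∀ y x : ℝ, ∫ u in Ioi (1 : ℝ),
      exp (-(π * β * ((1 - y) ^ 2 + x ^ 2) * u / y)) * u⁻¹ =
      (∫⁻ u in Ioi (1 : ℝ), ENNReal.ofReal
        (exp (-(π * β * ((1 - y) ^ 2 + x ^ 2) * u / y)) * u⁻¹)).toReal := fun y x => by
    refine integral_eq_lintegral_of_nonneg_ae ?_
      (Measurable.aestronglyMeasurable (by fun_prop))
    filter_upwards [ae_restrict_mem measurableSet_Ioi] with u hu
    have : 0 < u := zero_lt_one.trans hu
    simp only [Pi.zero_apply]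
    positivity
  simp_rw [hu]
  rw [integral_toReal_lintegral_mul (c := fun y => (y ^ 2)⁻¹), lintegral_unfolded_green hβ,
    ENNReal.toReal_ofReal (by positivity)]
  · exact Measurable.lintegral_prod_right' (f := fun p : (ℝ × ℝ) × ℝ => ENNReal.ofReal
      (exp (-(π * β * ((1 - p.1.1) ^ 2 + p.1.2 ^ 2) * p.2 / p.1.1)) * p.2⁻¹)) (by fun_prop)
  · fun_prop
  · filter_upwards [ae_restrict_mem measurableSet_Ioi] with y hy
    have : 0 < y := hy
    positivity
  · rw [lintegral_unfolded_green hβ]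
    exact ENNReal.ofReal_ne_top
end

section
/- For every real β > 0 one has ∫₀^∞ ∫_{−∞}^{∞} ∫₁^∞ e^{−πβ·((1+y)² + x²)·u/y} · u^{−1} du dx · y^{−2} dy = (1/β)·e^{−4πβ} − 4π·∫₁^∞ e^{−4πβu}·u^{−1} du. That is, the integral over the upper half plane ℍ (with hyperbolic measure dμ(z) = dx dy/y²) of ∫₁^∞ e^{−πβ(1/y)((1+y)²+x²)u} du/u equals (1/β)(e^{−4πβ} + 4πβ·Ei(−4πβ)), where Ei(−x) = −∫₁^∞ e^{−xt} t^{−1} dt. -/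
open Real MeasureTheory Set

lemma hasDerivAt_sqrt_sub_inv_sqrt {y : ℝ} (hy : 0 < y) :
    HasDerivAt (fun y : ℝ => √y - (√y)⁻¹) (2⁻¹ * (√y * y⁻¹ + √y * (y ^ 2)⁻¹)) y := by
  have hs : 0 < √y := Real.sqrt_pos.2 hy
  have h := Real.hasDerivAt_sqrt hy.ne'
  refine (h.sub (h.inv hs.ne')).congr_deriv ?_
  clear h
  obtain ⟨s, hs', rfl⟩ : ∃ s : ℝ, 0 < s ∧ y = s ^ 2 := ⟨√y, hs, (Real.sq_sqrt hy.le).symm⟩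
  rw [Real.sqrt_sq hs'.le]
  field_simp
  ring

lemma injOn_sqrt_sub_inv_sqrt : InjOn (fun y : ℝ => √y - (√y)⁻¹) (Ioi 0) := by
  refine StrictMonoOn.injOn fun x hx y _ hxy => ?_
  have h0 : 0 < √x := Real.sqrt_pos.2 hx
  have h1 : √x < √y := Real.sqrt_lt_sqrt (le_of_lt hx) hxy
  have h2 : (√y)⁻¹ < (√x)⁻¹ := inv_strictAnti₀ h0 h1
  show √x - (√x)⁻¹ < √y - (√y)⁻¹
  linarith

lemma image_sqrt_sub_inv_sqrt : (fun y : ℝ => √y - (√y)⁻¹) '' Ioi 0 = univ := by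
  refine eq_univ_of_forall fun t => ?_
  have hlt : |t| < √(t ^ 2 + 4) := by
    rw [← Real.sqrt_sq_eq_abs]
    exact Real.sqrt_lt_sqrt (sq_nonneg t) (by linarith)
  have hs : 0 < (t + √(t ^ 2 + 4)) / 2 := by linarith [neg_abs_le t]
  have hq : √(t ^ 2 + 4) ^ 2 = t ^ 2 + 4 := Real.sq_sqrt (by positivity)
  refine ⟨((t + √(t ^ 2 + 4)) / 2) ^ 2, pow_pos hs 2, ?_⟩
  show √(((t + √(t ^ 2 + 4)) / 2) ^ 2) - (√(((t + √(t ^ 2 + 4)) / 2) ^ 2))⁻¹ = t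
  rw [Real.sqrt_sq hs.le]
  generalize √(t ^ 2 + 4) = r at *
  have hne : t + r ≠ 0 := by linarith
  field_simp
  linarith

lemma one_add_sq_div_eq {y : ℝ} (hy : 0 < y) :
    (1 + y) ^ 2 / y = (√y - (√y)⁻¹) ^ 2 + 4 := by
  obtain ⟨s, hs', rfl⟩ : ∃ s : ℝ, 0 < s ∧ y = s ^ 2 :=
    ⟨√y, Real.sqrt_pos.2 hy, (Real.sq_sqrt hy.le).symm⟩
  rw [Real.sqrt_sq hs'.le]
  field_simp
  ring

lemma abs_deriv_smul_gaussian_eq {c y : ℝ} (hy : 0 < y) :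
    |2⁻¹ * (√y * y⁻¹ + √y * (y ^ 2)⁻¹)| •
        (Real.exp (-(4 * c)) * Real.exp (-c * (√y - (√y)⁻¹) ^ 2)) =
      2⁻¹ * (√y * y⁻¹ * Real.exp (-(c * ((1 + y) ^ 2 / y))) +
        √y * (y ^ 2)⁻¹ * Real.exp (-(c * ((1 + y) ^ 2 / y)))) := by
  rw [abs_of_nonneg (by positivity), one_add_sq_div_eq hy, ← Real.exp_add, smul_eq_mul,
    show -(4 * c) + -c * (√y - (√y)⁻¹) ^ 2 = -(c * ((√y - (√y)⁻¹) ^ 2 + 4)) by ring]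
  ring

lemma integrableOn_bessel_sum {c : ℝ} (hc : 0 < c) :
    IntegrableOn (fun y : ℝ => 2⁻¹ * (√y * y⁻¹ * Real.exp (-(c * ((1 + y) ^ 2 / y))) +
        √y * (y ^ 2)⁻¹ * Real.exp (-(c * ((1 + y) ^ 2 / y))))) (Ioi 0) := by
  have h := (integrableOn_image_iff_integrableOn_abs_deriv_smul measurableSet_Ioi
    (fun y hy => (hasDerivAt_sqrt_sub_inv_sqrt hy).hasDerivWithinAt) injOn_sqrt_sub_inv_sqrt
    (fun t => Real.exp (-(4 * c)) * Real.exp (-c * t ^ 2))).1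
    (by
      rw [image_sqrt_sub_inv_sqrt, integrableOn_univ]
      exact (integrable_exp_neg_mul_sq hc).const_mul _)
  exact h.congr_fun (fun y hy => abs_deriv_smul_gaussian_eq hy) measurableSet_Ioi

lemma integral_bessel_sum (c : ℝ) :
    ∫ y in Ioi (0 : ℝ), 2⁻¹ * (√y * y⁻¹ * Real.exp (-(c * ((1 + y) ^ 2 / y))) +
        √y * (y ^ 2)⁻¹ * Real.exp (-(c * ((1 + y) ^ 2 / y)))) =
      Real.exp (-(4 * c)) * √(π / c) := by
  have h := integral_image_eq_integral_abs_deriv_smul measurableSet_Ioi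
    (fun y hy => (hasDerivAt_sqrt_sub_inv_sqrt hy).hasDerivWithinAt) injOn_sqrt_sub_inv_sqrt
    (fun t => Real.exp (-(4 * c)) * Real.exp (-c * t ^ 2))
  rw [image_sqrt_sub_inv_sqrt, setIntegral_univ, integral_const_mul, integral_gaussian] at h
  rw [h]
  exact (setIntegral_congr_fun measurableSet_Ioi
    fun y hy => abs_deriv_smul_gaussian_eq hy).symm

lemma integrableOn_sqrt_mul_inv_sq_mul_exp {c : ℝ} (hc : 0 < c) :
    IntegrableOn (fun y : ℝ => √y * (y ^ 2)⁻¹ * Real.exp (-(c * ((1 + y) ^ 2 / y))))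
      (Ioi 0) := by
  refine ((integrableOn_bessel_sum hc).const_mul 2).mono'
    (Measurable.aestronglyMeasurable (by fun_prop)) ?_
  filter_upwards [ae_restrict_mem measurableSet_Ioi] with y hy
  have hy : 0 < y := hy
  rw [Real.norm_of_nonneg (by positivity)]
  have : 0 ≤ √y * y⁻¹ * Real.exp (-(c * ((1 + y) ^ 2 / y))) := by positivity
  linarith

lemma integrableOn_sqrt_mul_inv_mul_exp {c : ℝ} (hc : 0 < c) :
    IntegrableOn (fun y : ℝ => √y * y⁻¹ * Real.exp (-(c * ((1 + y) ^ 2 / y))))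
      (Ioi 0) := by
  refine ((integrableOn_bessel_sum hc).const_mul 2).mono'
    (Measurable.aestronglyMeasurable (by fun_prop)) ?_
  filter_upwards [ae_restrict_mem measurableSet_Ioi] with y hy
  have hy : 0 < y := hy
  rw [Real.norm_of_nonneg (by positivity)]
  have : 0 ≤ √y * (y ^ 2)⁻¹ * Real.exp (-(c * ((1 + y) ^ 2 / y))) := by positivity
  linarith

lemma integral_sqrt_mul_inv_eq_integral_sqrt_mul_inv_sq (c : ℝ) :
    ∫ y in Ioi (0 : ℝ), √y * y⁻¹ * Real.exp (-(c * ((1 + y) ^ 2 / y))) =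
      ∫ y in Ioi (0 : ℝ), √y * (y ^ 2)⁻¹ * Real.exp (-(c * ((1 + y) ^ 2 / y))) := by
  have himg : (fun y : ℝ => y⁻¹) '' Ioi 0 = Ioi 0 := by
    ext t
    refine ⟨?_, fun ht => ⟨t⁻¹, inv_pos.2 (mem_Ioi.1 ht), inv_inv t⟩⟩
    rintro ⟨y, hy, rfl⟩
    exact inv_pos.2 (mem_Ioi.1 hy)
  have h := integral_image_eq_integral_abs_deriv_smul (s := Ioi (0 : ℝ)) measurableSet_Ioi
    (fun y hy => (hasDerivAt_inv (ne_of_gt (mem_Ioi.1 hy))).hasDerivWithinAt)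
    (inv_injective.injOn)
    (fun y => √y * y⁻¹ * Real.exp (-(c * ((1 + y) ^ 2 / y))))
  rw [himg] at h
  rw [h]
  refine setIntegral_congr_fun measurableSet_Ioi fun y hy => ?_
  have hy : 0 < y := hy
  have harg : (1 + y⁻¹) ^ 2 / y⁻¹ = (1 + y) ^ 2 / y := by
    field_simp
    ring
  have hs : (√y)⁻¹ * y = √y := by
    rw [inv_mul_eq_div, Real.div_sqrt]
  simp only [harg, smul_eq_mul, abs_neg, Real.sqrt_inv, inv_inv, hs]
  rw [abs_of_nonneg (by positivity)]
  ring

lemma integral_sqrt_mul_inv_sq_mul_exp {c : ℝ} (hc : 0 < c) :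
    ∫ y in Ioi (0 : ℝ), √y * (y ^ 2)⁻¹ * Real.exp (-(c * ((1 + y) ^ 2 / y))) =
      Real.exp (-(4 * c)) * √(π / c) := by
  have h := integral_bessel_sum c
  rw [integral_const_mul, integral_add (integrableOn_sqrt_mul_inv_mul_exp hc)
    (integrableOn_sqrt_mul_inv_sq_mul_exp hc),
    integral_sqrt_mul_inv_eq_integral_sqrt_mul_inv_sq] at h
  linarith

lemma integrableOn_exp_neg_mul_mul_of_abs_le_one {a : ℝ} (ha : 0 < a) {g : ℝ → ℝ}
    (hg : Measurable g) (hg1 : ∀ u, 1 < u → |g u| ≤ 1) :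
    IntegrableOn (fun u => Real.exp (-(a * u)) * g u) (Ioi 1) := by
  refine (integrableOn_exp_mul_Ioi (neg_lt_zero.2 ha) 1).mono'
    (Measurable.aestronglyMeasurable (by fun_prop)) ?_
  filter_upwards [ae_restrict_mem measurableSet_Ioi] with u hu
  rw [norm_mul, Real.norm_of_nonneg (Real.exp_nonneg _), neg_mul]
  exact mul_le_of_le_one_right (Real.exp_nonneg _) (hg1 u hu)

lemma integrableOn_exp_neg_mul_mul_inv {a : ℝ} (ha : 0 < a) :
    IntegrableOn (fun u => Real.exp (-(a * u)) * u⁻¹) (Ioi 1) := by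
  refine integrableOn_exp_neg_mul_mul_of_abs_le_one ha measurable_inv fun u hu => ?_
  rw [abs_of_nonneg (by positivity)]
  exact inv_le_one_of_one_le₀ hu.le

lemma integrableOn_exp_neg_mul_mul_inv_sq {a : ℝ} (ha : 0 < a) :
    IntegrableOn (fun u => Real.exp (-(a * u)) * (u ^ 2)⁻¹) (Ioi 1) := by
  refine integrableOn_exp_neg_mul_mul_of_abs_le_one ha (by fun_prop) fun u hu => ?_
  rw [abs_of_nonneg (by positivity)]
  exact inv_le_one_of_one_le₀ (one_le_pow₀ hu.le)

lemma integral_exp_neg_mul_mul_inv_sq {a : ℝ} (ha : 0 < a) :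
    ∫ u in Ioi (1 : ℝ), Real.exp (-(a * u)) * (u ^ 2)⁻¹ =
      Real.exp (-a) - a * ∫ u in Ioi (1 : ℝ), Real.exp (-(a * u)) * u⁻¹ := by
  have hd : ∀ u ∈ Ici (1 : ℝ), HasDerivAt (fun u : ℝ => -(Real.exp (-(a * u)) * u⁻¹))
      (a * (Real.exp (-(a * u)) * u⁻¹) + Real.exp (-(a * u)) * (u ^ 2)⁻¹) u := by
    intro u hu
    have hu0 : u ≠ 0 := (zero_lt_one.trans_le (mem_Ici.1 hu)).ne'
    have h1 : HasDerivAt (fun u : ℝ => -(a * u)) (-a) u :=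
      ((hasDerivAt_id u).const_mul a).neg.congr_deriv (by rw [mul_one])
    refine (h1.exp.mul (hasDerivAt_inv hu0)).neg.congr_deriv ?_
    ring
  have ht : Filter.Tendsto (fun u : ℝ => -(Real.exp (-(a * u)) * u⁻¹)) Filter.atTop (nhds 0) := by
    have h1 : Filter.Tendsto (fun u : ℝ => Real.exp (-(a * u))) Filter.atTop (nhds 0) :=
      Real.tendsto_exp_neg_atTop_nhds_zero.comp (Filter.tendsto_id.const_mul_atTop ha)
    simpa using (h1.mul tendsto_inv_atTop_zero).neg
  have h1 := (integrableOn_exp_neg_mul_mul_inv ha).const_mul a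
  have h2 := integrableOn_exp_neg_mul_mul_inv_sq ha
  have h := integral_Ioi_of_hasDerivAt_of_tendsto' hd (h1.add h2) ht
  rw [integral_add h1 h2, integral_const_mul] at h
  simp only [mul_one, inv_one] at h
  linarith

lemma green_integrand_eq (β y x u : ℝ) :
    Real.exp (-(π * β * ((1 + y) ^ 2 + x ^ 2) * u / y)) * u⁻¹ =
      Real.exp (-(π * β * u * ((1 + y) ^ 2 / y))) * u⁻¹ *
        Real.exp (-(π * β * u / y) * x ^ 2) := by
  rw [mul_right_comm _ u⁻¹, ← Real.exp_add]
  congr 2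
  ring

lemma integral_green_integrand (β y u : ℝ) :
    ∫ x : ℝ, Real.exp (-(π * β * ((1 + y) ^ 2 + x ^ 2) * u / y)) * u⁻¹ =
      Real.exp (-(π * β * u * ((1 + y) ^ 2 / y))) * u⁻¹ * √(y / (β * u)) := by
  simp_rw [green_integrand_eq]
  rw [integral_const_mul, integral_gaussian]
  congr 2
  rw [div_div_eq_mul_div, mul_assoc π, mul_div_mul_left _ _ Real.pi_ne_zero]

lemma integrable_green_integrand {β y : ℝ} (hβ : 0 < β) (hy : 0 < y) :
    Integrable (Function.uncurry fun x u : ℝ =>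
      Real.exp (-(π * β * ((1 + y) ^ 2 + x ^ 2) * u / y)) * u⁻¹)
      (volume.prod (volume.restrict (Ioi 1))) := by
  refine (integrable_prod_iff' (Measurable.aestronglyMeasurable (by
    unfold Function.uncurry; fun_prop))).2 ⟨?_, ?_⟩
  · filter_upwards [ae_restrict_mem measurableSet_Ioi] with u hu
    have hu : 0 < u := zero_lt_one.trans hu
    simp only [Function.uncurry_apply_pair, green_integrand_eq]
    exact (integrable_exp_neg_mul_sq (by positivity)).const_mul _
  · have hc : 0 < π * β * ((1 + y) ^ 2 / y) := by positivity
    refine IntegrableOn.congr_fun ((integrableOn_exp_neg_mul_mul_of_abs_le_one hc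
      (g := fun u => u⁻¹ * √u⁻¹) (by fun_prop) fun u hu => ?_).mul_const √(y / β))
      (fun u hu => ?_) measurableSet_Ioi
    · have hi : u⁻¹ ≤ 1 := inv_le_one_of_one_le₀ hu.le
      rw [abs_of_nonneg (by positivity)]
      exact mul_le_one₀ hi (Real.sqrt_nonneg _) (Real.sqrt_le_one.2 hi)
    · have hu : 0 < u := zero_lt_one.trans hu
      have hn : ∀ x : ℝ, ‖Real.exp (-(π * β * ((1 + y) ^ 2 + x ^ 2) * u / y)) * u⁻¹‖ =
          Real.exp (-(π * β * ((1 + y) ^ 2 + x ^ 2) * u / y)) * u⁻¹ := fun x =>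
        Real.norm_of_nonneg (by positivity)
      simp only [Function.uncurry_apply_pair, hn, integral_green_integrand]
      rw [← div_div, div_eq_mul_inv (y / β) u, Real.sqrt_mul (by positivity)]
      ring_nf

lemma green_fiber_mul_inv_sq_eq {β y u : ℝ} (hy : 0 < y) :
    Real.exp (-(π * β * u * ((1 + y) ^ 2 / y))) * u⁻¹ * √(y / (β * u)) * (y ^ 2)⁻¹ =
      u⁻¹ * √(β * u)⁻¹ *
        (√y * (y ^ 2)⁻¹ * Real.exp (-(π * β * u * ((1 + y) ^ 2 / y)))) := by
  rw [div_eq_mul_inv y, Real.sqrt_mul hy.le]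
  ring

lemma integral_green_fiber {β u : ℝ} (hβ : 0 < β) (hu : 0 < u) :
    ∫ y in Ioi (0 : ℝ),
        Real.exp (-(π * β * u * ((1 + y) ^ 2 / y))) * u⁻¹ * √(y / (β * u)) * (y ^ 2)⁻¹ =
      1 / β * (Real.exp (-(4 * π * β * u)) * (u ^ 2)⁻¹) := by
  rw [setIntegral_congr_fun measurableSet_Ioi fun y hy => green_fiber_mul_inv_sq_eq hy,
    integral_const_mul, integral_sqrt_mul_inv_sq_mul_exp (by positivity)]
  have h1 : π / (π * β * u) = (β * u)⁻¹ := by field_simp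
  have h2 : √(β * u)⁻¹ * √(β * u)⁻¹ = (β * u)⁻¹ := Real.mul_self_sqrt (by positivity)
  rw [h1, show 4 * (π * β * u) = 4 * π * β * u by ring]
  calc u⁻¹ * √(β * u)⁻¹ * (Real.exp (-(4 * π * β * u)) * √(β * u)⁻¹)
      = u⁻¹ * (√(β * u)⁻¹ * √(β * u)⁻¹) * Real.exp (-(4 * π * β * u)) := by ring
    _ = _ := by rw [h2]; field_simp

lemma integrable_green_fiber {β : ℝ} (hβ : 0 < β) :
    Integrable (Function.uncurry fun y u : ℝ =>
      Real.exp (-(π * β * u * ((1 + y) ^ 2 / y))) * u⁻¹ * √(y / (β * u)) * (y ^ 2)⁻¹)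
      ((volume.restrict (Ioi 0)).prod (volume.restrict (Ioi 1))) := by
  refine (integrable_prod_iff' (Measurable.aestronglyMeasurable (by
    unfold Function.uncurry; fun_prop))).2 ⟨?_, ?_⟩
  · filter_upwards [ae_restrict_mem measurableSet_Ioi] with u hu
    have hu : 0 < u := zero_lt_one.trans hu
    exact IntegrableOn.congr_fun
      ((integrableOn_sqrt_mul_inv_sq_mul_exp (c := π * β * u) (by positivity)).const_mul _)
      (fun y hy => (green_fiber_mul_inv_sq_eq hy).symm) measurableSet_Ioi
  · refine IntegrableOn.congr_fun ((integrableOn_exp_neg_mul_mul_inv_sq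
      (a := 4 * π * β) (by positivity)).const_mul (1 / β)) (fun u hu => ?_) measurableSet_Ioi
    have hu : 0 < u := zero_lt_one.trans hu
    have hn : ∀ y : ℝ, ‖Real.exp (-(π * β * u * ((1 + y) ^ 2 / y))) * u⁻¹ * √(y / (β * u)) *
        (y ^ 2)⁻¹‖ = Real.exp (-(π * β * u * ((1 + y) ^ 2 / y))) * u⁻¹ * √(y / (β * u)) *
        (y ^ 2)⁻¹ := fun y => Real.norm_of_nonneg (by positivity)
    simp only [Function.uncurry_apply_pair, hn, integral_green_fiber hβ hu]

/-- The unfolded Green function integral for negative index: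
`∫_ℍ ∫₁^∞ e^{−πβ(1/y)((1+y)²+x²)u} du/u dμ(z)
  = (1/β)·e^{−4πβ} − 4π·∫₁^∞ e^{−4πβu}/u du`. -/
theorem unfolded_green_integral_neg (β : ℝ) (hβ : 0 < β) :
    (∫ y in Ioi (0 : ℝ),
        (∫ x : ℝ, ∫ u in Ioi (1 : ℝ),
          Real.exp (-(π * β * ((1 + y) ^ 2 + x ^ 2) * u / y)) * u⁻¹) * (y ^ 2)⁻¹) =
      1 / β * Real.exp (-(4 * π * β)) -
        4 * π * ∫ u in Ioi (1 : ℝ), Real.exp (-(4 * π * β * u)) * u⁻¹ := by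
  have hfiber : ∀ y ∈ Ioi (0 : ℝ),
      (∫ x : ℝ, ∫ u in Ioi (1 : ℝ),
          Real.exp (-(π * β * ((1 + y) ^ 2 + x ^ 2) * u / y)) * u⁻¹) * (y ^ 2)⁻¹ =
        ∫ u in Ioi (1 : ℝ), Real.exp (-(π * β * u * ((1 + y) ^ 2 / y))) * u⁻¹ *
          √(y / (β * u)) * (y ^ 2)⁻¹ := fun y hy => by
    rw [integral_integral_swap (integrable_green_integrand hβ hy), ← integral_mul_const]
    simp_rw [integral_green_integrand]
  rw [setIntegral_congr_fun measurableSet_Ioi hfiber,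
    integral_integral_swap (integrable_green_fiber hβ),
    setIntegral_congr_fun measurableSet_Ioi
      fun u hu => integral_green_fiber hβ (zero_lt_one.trans hu),
    integral_const_mul, integral_exp_neg_mul_mul_inv_sq (by positivity)]
  field_simp
end

section
/- For every real α > 0 one has ∫₁^∞ e^{−αr}·log(r²−1) dr = (e^{α}/α)·∫₁^∞ e^{−2αt}·t^{−1} dt − (e^{−α}/α)·(log(α/2) + γ), where γ is the Euler–Mascheroni constant. (Equivalently, ∫₁^∞ e^{−αr} log(r²−1) dr = e^{α}(1/α)(−Ei(−2α)) − e^{−α}(1/α)(log(α/2)+γ) with Ei(−x) = −∫₁^∞ e^{−xt} t^{−1} dt.) -/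
open Real MeasureTheory Set

open Filter Topology in
theorem integral_exp_neg_mul_log :
    ∫ t in Ioi (0 : ℝ), Real.exp (-t) * Real.log t = -Real.eulerMascheroniConstant := by
  have h := (Complex.hasDerivAt_GammaIntegral (s := 1) (by simp)).congr_of_eventuallyEq
    (f₁ := Complex.Gamma) (by
      filter_upwards [(isOpen_lt continuous_const Complex.continuous_re).mem_nhds
        (show (0 : ℝ) < (1 : ℂ).re by simp)] with s hs using Complex.Gamma_eq_integral hs)
  have h2 := h.unique Complex.hasDerivAt_Gamma_one
  simp only [sub_self, Complex.cpow_zero, one_mul] at h2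
  simp only [← Complex.ofReal_mul, ← Complex.ofReal_neg, integral_complex_ofReal] at h2
  simpa only [mul_comm] using Complex.ofReal_injective h2

theorem integrableOn_exp_neg_mul_log :
    IntegrableOn (fun t : ℝ => Real.exp (-t) * Real.log t) (Ioi 0) := by
  by_contra h
  have h0 := integral_exp_neg_mul_log
  rw [integral_undef h] at h0
  linarith [Real.one_half_lt_eulerMascheroniConstant]

theorem integrableOn_exp_neg_const_mul (c : ℝ) {α : ℝ} (hα : 0 < α) :
    IntegrableOn (fun t : ℝ => Real.exp (-(α * t))) (Ioi c) := by
  simpa only [neg_mul] using integrableOn_exp_mul_Ioi (neg_lt_zero.mpr hα) c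

theorem exp_neg_const_mul_mul_log {α t : ℝ} (hα : 0 < α) (ht : 0 < t) :
    Real.exp (-(α * t)) * Real.log t =
      Real.exp (-(α * t)) * Real.log (α * t) - Real.log α * Real.exp (-(α * t)) := by
  rw [Real.log_mul hα.ne' ht.ne']
  ring

theorem integrableOn_exp_neg_const_mul_mul_log_const_mul {α : ℝ} (hα : 0 < α) :
    IntegrableOn (fun t : ℝ => Real.exp (-(α * t)) * Real.log (α * t)) (Ioi 0) := by
  simpa using (integrableOn_Ioi_comp_mul_left_iff
    (fun t : ℝ => Real.exp (-t) * Real.log t) 0 hα).mpr (by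
      simpa using integrableOn_exp_neg_mul_log)

theorem integrableOn_exp_neg_const_mul_mul_log {α : ℝ} (hα : 0 < α) :
    IntegrableOn (fun t : ℝ => Real.exp (-(α * t)) * Real.log t) (Ioi 0) :=
  ((integrableOn_exp_neg_const_mul_mul_log_const_mul hα).sub
    ((integrableOn_exp_neg_const_mul 0 hα).const_mul (Real.log α))).congr_fun
    (fun _ ht => (exp_neg_const_mul_mul_log hα ht).symm) measurableSet_Ioi

theorem integral_exp_neg_const_mul_mul_log {α : ℝ} (hα : 0 < α) :
    ∫ t in Ioi (0 : ℝ), Real.exp (-(α * t)) * Real.log t =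
      -(Real.log α + Real.eulerMascheroniConstant) / α := by
  rw [setIntegral_congr_fun measurableSet_Ioi fun _ ht => exp_neg_const_mul_mul_log hα ht,
    integral_sub (integrableOn_exp_neg_const_mul_mul_log_const_mul hα)
      ((integrableOn_exp_neg_const_mul 0 hα).const_mul (Real.log α)), integral_const_mul,
    integral_comp_mul_left_Ioi (fun t => Real.exp (-t) * Real.log t) 0 hα,
    integral_comp_mul_left_Ioi (fun t => Real.exp (-t)) 0 hα, mul_zero,
    integral_exp_neg_mul_log, integral_exp_neg_Ioi_zero]
  simp only [smul_eq_mul]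
  ring

open Filter Topology in
theorem tendsto_exp_neg_const_mul_mul_log {α : ℝ} (hα : 0 < α) :
    Tendsto (fun t : ℝ => Real.exp (-(α * t)) * Real.log t) atTop (𝓝 0) := by
  have h := (Real.isLittleO_log_id_atTop.trans
    (isLittleO_pow_exp_pos_mul_atTop 1 hα |>.congr_left fun x => pow_one x)).tendsto_div_nhds_zero
  refine h.congr fun t => ?_
  rw [Real.exp_neg, div_eq_inv_mul]

theorem integrableOn_exp_neg_const_mul_mul_inv {α c : ℝ} (hα : 0 < α) (hc : 0 < c) :
    IntegrableOn (fun t : ℝ => Real.exp (-(α * t)) * t⁻¹) (Ioi c) := by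
  refine ((integrableOn_exp_neg_const_mul c hα).mul_const c⁻¹).mono'
    (by fun_prop) ?_
  filter_upwards [ae_restrict_mem measurableSet_Ioi] with t ht
  have ht0 : 0 < t := hc.trans ht
  rw [Real.norm_of_nonneg (by positivity)]
  gcongr
  exact le_of_lt ht

/-- Integration by parts against the logarithm. -/
theorem integral_Ioi_exp_neg_const_mul_mul_log {α c : ℝ} (hα : 0 < α) (hc : 0 < c) :
    ∫ t in Ioi c, Real.exp (-(α * t)) * Real.log t =
      Real.exp (-(α * c)) * Real.log c / α +
        (∫ t in Ioi c, Real.exp (-(α * t)) * t⁻¹) / α := by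
  have hlog := (integrableOn_exp_neg_const_mul_mul_log hα).mono_set (Ioi_subset_Ioi hc.le)
  have hinv := (integrableOn_exp_neg_const_mul_mul_inv hα hc).div_const α
  have h := integral_Ioi_of_hasDerivAt_of_tendsto'
    (f := fun t => -(Real.exp (-(α * t)) * Real.log t) / α) (a := c)
    (fun t ht => ?_) (hlog.sub hinv)
    (by simpa using (tendsto_exp_neg_const_mul_mul_log hα).neg.div_const α)
  · rw [integral_sub' hlog hinv, integral_div] at h
    linear_combination h
  · have ht0 : t ≠ 0 := (hc.trans_le ht).ne'
    convert! ((((hasDerivAt_id t).const_mul α).neg.exp.mul (Real.hasDerivAt_log ht0)).neg.div_const α)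
      using 1
    simp
    field

theorem integral_comp_add_right_Ioi (f : ℝ → ℝ) (a d : ℝ) :
    ∫ x in Ioi a, f (x + d) = ∫ x in Ioi (a + d), f x := by
  simpa using (measurePreserving_add_right volume d).setIntegral_preimage_emb
    (MeasurableEquiv.addRight d).measurableEmbedding f (Ioi (a + d))

theorem integrableOn_comp_add_right_Ioi_iff (f : ℝ → ℝ) (a d : ℝ) :
    IntegrableOn (fun x => f (x + d)) (Ioi a) ↔ IntegrableOn f (Ioi (a + d)) := by
  simpa [Function.comp_def] using (measurePreserving_add_right volume d).integrableOn_comp_preimage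
    (MeasurableEquiv.addRight d).measurableEmbedding (f := f) (s := Ioi (a + d))

/-- `∫₁^∞ e^{−αr}·log(r²−1) dr = (e^α/α)·∫₁^∞ e^{−2αt}/t dt − (e^{−α}/α)·(log(α/2)+γ)`. -/
theorem integral_exp_log_sq_sub_one (α : ℝ) (hα : 0 < α) :
    (∫ r in Ioi (1 : ℝ), Real.exp (-(α * r)) * Real.log (r ^ 2 - 1)) =
      Real.exp α / α * (∫ t in Ioi (1 : ℝ), Real.exp (-(2 * α * t)) * t⁻¹) -
        Real.exp (-α) / α * (Real.log (α / 2) + Real.eulerMascheroniConstant) := by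
  let f : ℝ → ℝ := fun t => Real.exp (-(α * t)) * Real.log t
  have hf : IntegrableOn f (Ioi 0) := integrableOn_exp_neg_const_mul_mul_log hα
  have hsub : IntegrableOn (fun r => f (r + -1)) (Ioi 1) := by
    rw [integrableOn_comp_add_right_Ioi_iff f]
    simpa using hf
  have hadd : IntegrableOn (fun r => f (r + 1)) (Ioi 1) := by
    rw [integrableOn_comp_add_right_Ioi_iff f]
    exact hf.mono_set (Ioi_subset_Ioi (by norm_num))
  have hsplit : EqOn (fun r => Real.exp (-(α * r)) * Real.log (r ^ 2 - 1))
      (fun r => Real.exp (-α) * f (r + -1) + Real.exp α * f (r + 1)) (Ioi 1) := by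
    intro r hr
    have hr1 : 1 < r := hr
    simp only [f]
    rw [show r ^ 2 - 1 = (r + -1) * (r + 1) by ring,
      Real.log_mul (by linarith) (by linarith), ← mul_assoc, ← mul_assoc, ← Real.exp_add,
      ← Real.exp_add]
    ring_nf
  have hei : ∫ t in Ioi (2 : ℝ), Real.exp (-(α * t)) * t⁻¹ =
      ∫ t in Ioi (1 : ℝ), Real.exp (-(2 * α * t)) * t⁻¹ := by
    have h := integral_comp_mul_left_Ioi' (fun t : ℝ => Real.exp (-(α * t)) * t⁻¹) 1 two_pos
    rw [mul_one] at h
    rw [← h, smul_eq_mul, ← integral_const_mul]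
    congr with t
    rw [mul_inv, show α * (2 * t) = 2 * α * t by ring]
    ring
  rw [setIntegral_congr_fun measurableSet_Ioi hsplit,
    integral_add (hsub.const_mul _) (hadd.const_mul _), integral_const_mul, integral_const_mul,
    integral_comp_add_right_Ioi, integral_comp_add_right_Ioi, add_neg_cancel, one_add_one_eq_two,
    integral_exp_neg_const_mul_mul_log hα, integral_Ioi_exp_neg_const_mul_mul_log hα two_pos, hei,
    Real.log_div hα.ne' two_ne_zero]
  have hexp : Real.exp α * Real.exp (-(α * 2)) = Real.exp (-α) := by
    rw [← Real.exp_add]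
    ring_nf
  linear_combination Real.log 2 / α * hexp
end

section
/- For every real α > 0 one has ∫₁^∞ e^{−αr}·r·log(r²−1) dr = −e^{α}·(1/α − 1/α²)·∫₁^∞ e^{−2αt}·t^{−1} dt + (e^{−α}/α²)·( 2 − (1+α)·(log(α/2) + γ) ), where γ is the Euler–Mascheroni constant. (Equivalently, ∫₁^∞ e^{−αr} r log(r²−1) dr = e^{α}·Ei(−2α)·((1/α)−(1/α²)) + e^{−α}(1/α²)(2 − (log(α/2)+γ)(1+α)) with Ei(−x) = −∫₁^∞ e^{−xt} t^{−1} dt.) -/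
open Real MeasureTheory Set

open Filter
open scoped Nat Topology

/-- Translating the domain of integration of an integral over a half-line. -/
lemma setIntegral_Ioi_comp_add_right (f : ℝ → ℝ) (a b : ℝ) :
    ∫ x in Ioi a, f (x + b) = ∫ x in Ioi (a + b), f x := by
  have h := (measurePreserving_add_right (volume : Measure ℝ) b).setIntegral_preimage_emb
    (measurableEmbedding_addRight b) f (Ioi (a + b))
  simpa using h

/-- Integrability on a half-line is invariant under translation. -/
lemma integrableOn_Ioi_comp_add_right_iff (f : ℝ → ℝ) (a b : ℝ) :
    IntegrableOn (fun x ↦ f (x + b)) (Ioi a) ↔ IntegrableOn f (Ioi (a + b)) := by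
  have h := (measurePreserving_add_right (volume : Measure ℝ) b).integrableOn_comp_preimage
    (measurableEmbedding_addRight b) (f := f) (s := Ioi (a + b))
  simpa [Function.comp_def] using h

lemma integral_pow_mul_log_mul_exp_neg (n : ℕ) :
    ∫ x in Ioi (0 : ℝ), x ^ n * log x * exp (-x) =
      n ! * (-eulerMascheroniConstant + harmonic n) := by
  have hpos : (0 : ℝ) < ((n : ℂ) + 1).re := by
    simp only [Complex.add_re, Complex.natCast_re, Complex.one_re]; positivity
  have h1 := Complex.hasDerivAt_GammaIntegral hpos
  have h2 : HasDerivAt Complex.GammaIntegral _ ((n : ℂ) + 1) :=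
    (Complex.hasDerivAt_Gamma_nat n).congr_of_eventuallyEq <| by
      filter_upwards [(isOpen_lt continuous_const Complex.continuous_re).mem_nhds hpos] with z hz
        using (Complex.Gamma_eq_integral hz).symm
  have h3 := h1.unique h2
  have h4 : ∀ t : ℝ, (t : ℂ) ^ ((n : ℂ) + 1 - 1) * (log t * exp (-t)) =
      ((t ^ n * log t * exp (-t) : ℝ) : ℂ) := by
    intro t
    rw [add_sub_cancel_right, Complex.cpow_natCast]
    push_cast
    ring
  simp_rw [h4] at h3
  rw [integral_complex_ofReal] at h3
  exact_mod_cast h3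

lemma integrableOn_pow_mul_log_mul_exp_neg (n : ℕ) :
    IntegrableOn (fun x : ℝ ↦ x ^ n * log x * exp (-x)) (Ioi 0) := by
  refine not_imp_comm.mp integral_undef ?_
  rw [integral_pow_mul_log_mul_exp_neg]
  have hγ := one_half_lt_eulerMascheroniConstant
  have hγ' := eulerMascheroniConstant_lt_two_thirds
  refine mul_ne_zero (by positivity) ?_
  rcases n with - | n
  · simp only [harmonic_zero, Rat.cast_zero, add_zero]
    linarith
  · have : (1 : ℚ) ≤ harmonic (n + 1) := by
      rw [harmonic, Finset.sum_range_succ']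
      have : (0 : ℚ) ≤ ∑ k ∈ Finset.range n, ((k + 1 + 1 : ℕ) : ℚ)⁻¹ :=
        Finset.sum_nonneg fun _ _ ↦ by positivity
      simpa using this
    have : (1 : ℝ) ≤ harmonic (n + 1) := by exact_mod_cast this
    linarith

lemma integrableOn_pow_mul_exp_neg_mul (n : ℕ) {a : ℝ} (ha : 0 < a) :
    IntegrableOn (fun x : ℝ ↦ x ^ n * exp (-(a * x))) (Ioi 0) := by
  have h := integrableOn_rpow_mul_exp_neg_mul_rpow (p := 1) (s := n)
    (by linarith [n.cast_nonneg (α := ℝ)]) one_pos ha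
  simpa using h

lemma integral_pow_mul_exp_neg_mul (n : ℕ) {a : ℝ} (ha : 0 < a) :
    ∫ x in Ioi (0 : ℝ), x ^ n * exp (-(a * x)) = n ! / a ^ (n + 1) := by
  have h := integral_rpow_mul_exp_neg_mul_Ioi (a := n + 1) (r := a) (by positivity) ha
  rw [Gamma_nat_eq_factorial, add_sub_cancel_right, ← Nat.cast_add_one] at h
  simp only [rpow_natCast] at h
  rw [h, one_div_pow, one_div_mul_eq_div]

lemma pow_mul_log_mul_exp_neg_mul_eqOn (n : ℕ) {a : ℝ} (ha : 0 < a) :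
    EqOn (fun x : ℝ ↦ (a ^ n)⁻¹ * ((a * x) ^ n * log (a * x) * exp (-(a * x))) -
        log a * (x ^ n * exp (-(a * x))))
      (fun x ↦ x ^ n * log x * exp (-(a * x))) (Ioi 0) := by
  intro x hx
  simp only [log_mul ha.ne' (ne_of_gt hx), mul_pow]
  field_simp
  ring

lemma integrableOn_pow_mul_log_mul_exp_neg_mul (n : ℕ) {a : ℝ} (ha : 0 < a) :
    IntegrableOn (fun x : ℝ ↦ x ^ n * log x * exp (-(a * x))) (Ioi 0) := by
  have h := (integrableOn_Ioi_comp_mul_left_iff (fun x ↦ x ^ n * log x * exp (-x)) 0 ha).mpr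
    (by simpa using integrableOn_pow_mul_log_mul_exp_neg n)
  exact IntegrableOn.congr_fun
    ((h.const_mul _).sub ((integrableOn_pow_mul_exp_neg_mul n ha).const_mul _))
    (pow_mul_log_mul_exp_neg_mul_eqOn n ha) measurableSet_Ioi

lemma integral_pow_mul_log_mul_exp_neg_mul (n : ℕ) {a : ℝ} (ha : 0 < a) :
    ∫ x in Ioi (0 : ℝ), x ^ n * log x * exp (-(a * x)) =
      n ! / a ^ (n + 1) * (-eulerMascheroniConstant + harmonic n - log a) := by
  have h := (integrableOn_Ioi_comp_mul_left_iff (fun x ↦ x ^ n * log x * exp (-x)) 0 ha).mpr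
    (by simpa using integrableOn_pow_mul_log_mul_exp_neg n)
  rw [← setIntegral_congr_fun measurableSet_Ioi (pow_mul_log_mul_exp_neg_mul_eqOn n ha),
    integral_sub (h.const_mul _) ((integrableOn_pow_mul_exp_neg_mul n ha).const_mul _),
    integral_const_mul, integral_const_mul,
    integral_comp_mul_left_Ioi (fun x ↦ x ^ n * log x * exp (-x)) 0 ha, mul_zero,
    integral_pow_mul_log_mul_exp_neg, integral_pow_mul_exp_neg_mul n ha, smul_eq_mul]
  field_simp
  ring

lemma exp_neg_mul_mul_self_mul_log_sub_one_comp_add_one (a : ℝ) :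
    (fun x : ℝ ↦ exp (-(a * (x + 1))) * (x + 1) * log (x + 1 - 1)) =
      fun x ↦ exp (-a) * (x ^ 1 * log x * exp (-(a * x)) + x ^ 0 * log x * exp (-(a * x))) := by
  ext x
  rw [show -(a * (x + 1)) = -a + -(a * x) by ring, exp_add, add_sub_cancel_right]
  ring

lemma integrableOn_exp_neg_mul_mul_self_mul_log_sub_one {a : ℝ} (ha : 0 < a) :
    IntegrableOn (fun r : ℝ ↦ exp (-(a * r)) * r * log (r - 1)) (Ioi 1) := by
  have h := integrableOn_Ioi_comp_add_right_iff (fun r ↦ exp (-(a * r)) * r * log (r - 1)) 0 1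
  rw [zero_add, exp_neg_mul_mul_self_mul_log_sub_one_comp_add_one] at h
  exact h.mp (((integrableOn_pow_mul_log_mul_exp_neg_mul 1 ha).add
    (integrableOn_pow_mul_log_mul_exp_neg_mul 0 ha)).const_mul _)

lemma integral_exp_neg_mul_mul_self_mul_log_sub_one {a : ℝ} (ha : 0 < a) :
    ∫ r in Ioi (1 : ℝ), exp (-(a * r)) * r * log (r - 1) =
      exp (-a) / a ^ 2 * (1 - (1 + a) * (log a + eulerMascheroniConstant)) := by
  have h := setIntegral_Ioi_comp_add_right (fun r ↦ exp (-(a * r)) * r * log (r - 1)) 0 1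
  rw [zero_add, exp_neg_mul_mul_self_mul_log_sub_one_comp_add_one] at h
  rw [← h, integral_const_mul, integral_add (integrableOn_pow_mul_log_mul_exp_neg_mul 1 ha)
    (integrableOn_pow_mul_log_mul_exp_neg_mul 0 ha), integral_pow_mul_log_mul_exp_neg_mul 1 ha,
    integral_pow_mul_log_mul_exp_neg_mul 0 ha]
  simp only [harmonic_zero, harmonic_succ, Nat.factorial]
  push_cast
  field_simp
  ring

lemma integrableOn_exp_neg_mul_mul_self_mul_log_add_one {a : ℝ} (ha : 0 < a) :
    IntegrableOn (fun r : ℝ ↦ exp (-(a * r)) * r * log (r + 1)) (Ioi 1) := by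
  refine ((integrableOn_pow_mul_exp_neg_mul 2 ha).mono_set
    (Ioi_subset_Ioi zero_le_one)).mono' (by fun_prop) ?_
  filter_upwards [ae_restrict_mem measurableSet_Ioi] with r hr
  have hr : 1 < r := hr
  have h0 : 0 ≤ log (r + 1) := log_nonneg (by linarith)
  have h1 : log (r + 1) ≤ r := by linarith [log_le_sub_one_of_pos (show 0 < r + 1 by linarith)]
  rw [norm_of_nonneg (by positivity)]
  calc exp (-(a * r)) * r * log (r + 1) ≤ exp (-(a * r)) * r * r := by gcongr
    _ = r ^ 2 * exp (-(a * r)) := by ring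

lemma integrableOn_exp_neg_mul_div_add_one {a : ℝ} (ha : 0 < a) :
    IntegrableOn (fun r : ℝ ↦ exp (-(a * r)) / (r + 1)) (Ioi 1) := by
  refine ((integrableOn_pow_mul_exp_neg_mul 0 ha).mono_set
    (Ioi_subset_Ioi zero_le_one)).mono' (Measurable.aestronglyMeasurable (by fun_prop)) ?_
  filter_upwards [ae_restrict_mem measurableSet_Ioi] with r hr
  have hr : 1 < r := hr
  rw [norm_of_nonneg (by positivity), pow_zero, one_mul]
  exact div_le_self (exp_pos _).le (by linarith)

/-- The exponential integral `∫₁^∞ e^{-2at}/t dt`, moved to the variable `r = 2t - 1`. -/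
lemma integral_exp_neg_mul_div_add_one (a : ℝ) :
    ∫ r in Ioi (1 : ℝ), exp (-(a * r)) / (r + 1) =
      exp a * ∫ t in Ioi (1 : ℝ), exp (-(2 * a * t)) * t⁻¹ := by
  have h := setIntegral_Ioi_comp_add_right (fun s ↦ exp (-(a * (s - 1))) / s) 1 1
  have h' := integral_comp_mul_left_Ioi' (fun s ↦ exp (-(a * (s - 1))) / s) 1 two_pos
  simp only [add_sub_cancel_right] at h
  rw [h, show (1 : ℝ) + 1 = 2 * 1 by norm_num, ← h', smul_eq_mul, ← integral_const_mul,
    ← integral_const_mul]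
  congr 1 with t
  rw [show -(a * (2 * t - 1)) = a + -(2 * a * t) by ring, exp_add]
  field_simp

lemma tendsto_pow_mul_exp_neg_mul_atTop (n : ℕ) {a : ℝ} (ha : 0 < a) :
    Tendsto (fun x : ℝ ↦ x ^ n * exp (-(a * x))) atTop (𝓝 0) := by
  simpa using tendsto_rpow_mul_exp_neg_mul_atTop_nhds_zero n a ha

lemma tendsto_pow_mul_exp_neg_mul_mul_log_add_one_atTop (n : ℕ) {a : ℝ} (ha : 0 < a) :
    Tendsto (fun x : ℝ ↦ x ^ n * exp (-(a * x)) * log (x + 1)) atTop (𝓝 0) := by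
  refine squeeze_zero' ?_ ?_ (tendsto_pow_mul_exp_neg_mul_atTop (n + 1) ha)
  all_goals
    filter_upwards [eventually_ge_atTop 0] with x hx
  · have h0 : 0 ≤ log (x + 1) := log_nonneg (by linarith)
    positivity
  · have h1 : log (x + 1) ≤ x := by linarith [log_le_sub_one_of_pos (show 0 < x + 1 by linarith)]
    calc x ^ n * exp (-(a * x)) * log (x + 1) ≤ x ^ n * exp (-(a * x)) * x := by gcongr
      _ = x ^ (n + 1) * exp (-(a * x)) := by ring

lemma integral_exp_neg_mul_mul_self_mul_log_add_one {a : ℝ} (ha : 0 < a) :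
    ∫ r in Ioi (1 : ℝ), exp (-(a * r)) * r * log (r + 1) =
      (1 / a ^ 2 - 1 / a) * (∫ r in Ioi (1 : ℝ), exp (-(a * r)) / (r + 1)) +
        exp (-a) / a ^ 2 * (1 + (1 + a) * log 2) := by
  have hint := integrableOn_exp_neg_mul_mul_self_mul_log_add_one ha
  have hint' := (integrableOn_exp_neg_mul_div_add_one ha).const_mul (1 / a ^ 2 - 1 / a)
  have hderiv : ∀ r ∈ Ici (1 : ℝ), HasDerivAt
      (fun r ↦ -(exp (-(a * r)) * ((r / a + 1 / a ^ 2) * log (r + 1) + 1 / a ^ 2)))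
      (exp (-(a * r)) * r * log (r + 1) - (1 / a ^ 2 - 1 / a) * (exp (-(a * r)) / (r + 1))) r := by
    intro r hr
    have hr : 1 ≤ r := hr
    have hr1 : r + 1 ≠ 0 := by linarith
    have he : HasDerivAt (fun r ↦ exp (-(a * r))) (exp (-(a * r)) * -(a * 1)) r :=
      ((hasDerivAt_id r).const_mul a).fun_neg.exp
    have hl : HasDerivAt (fun r ↦ log (r + 1)) (1 / (r + 1)) r :=
      ((hasDerivAt_id r).add_const 1).log hr1
    have hp : HasDerivAt (fun r ↦ r / a + 1 / a ^ 2) (1 / a) r :=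
      ((hasDerivAt_id r).div_const a).add_const _
    refine (he.fun_mul ((hp.fun_mul hl).add_const (1 / a ^ 2))).fun_neg.congr_deriv ?_
    field_simp
    ring
  have hlim : Tendsto (fun r ↦ -(exp (-(a * r)) * ((r / a + 1 / a ^ 2) * log (r + 1) + 1 / a ^ 2)))
      atTop (𝓝 0) := by
    have h := ((((tendsto_pow_mul_exp_neg_mul_mul_log_add_one_atTop 1 ha).const_mul (1 / a)).add
      ((tendsto_pow_mul_exp_neg_mul_mul_log_add_one_atTop 0 ha).const_mul (1 / a ^ 2))).add
      ((tendsto_pow_mul_exp_neg_mul_atTop 0 ha).const_mul (1 / a ^ 2))).neg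
    simp only [mul_zero, add_zero, neg_zero] at h
    refine h.congr fun r ↦ ?_
    ring
  have h := integral_Ioi_of_hasDerivAt_of_tendsto' hderiv (hint.sub hint') hlim
  rw [integral_sub hint hint', integral_const_mul, sub_eq_iff_eq_add] at h
  rw [h, one_add_one_eq_two, mul_one]
  field_simp
  ring

/-- `∫₁^∞ e^{−αr}·r·log(r²−1) dr
  = −e^α·(1/α − 1/α²)·∫₁^∞ e^{−2αt}/t dt + (e^{−α}/α²)·(2 − (1+α)(log(α/2)+γ))`. -/
theorem integral_exp_mul_self_log_sq_sub_one (α : ℝ) (hα : 0 < α) :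
    (∫ r in Ioi (1 : ℝ), Real.exp (-(α * r)) * r * Real.log (r ^ 2 - 1)) =
      -Real.exp α * (1 / α - 1 / α ^ 2) *
          (∫ t in Ioi (1 : ℝ), Real.exp (-(2 * α * t)) * t⁻¹) +
        Real.exp (-α) / α ^ 2 *
          (2 - (1 + α) * (Real.log (α / 2) + Real.eulerMascheroniConstant)) := by
  have hsplit : EqOn (fun r : ℝ ↦ exp (-(α * r)) * r * log (r ^ 2 - 1))
      (fun r ↦ exp (-(α * r)) * r * log (r - 1) + exp (-(α * r)) * r * log (r + 1)) (Ioi 1) := by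
    intro r hr
    have hr : 1 < r := hr
    simp only
    rw [show r ^ 2 - 1 = (r - 1) * (r + 1) by ring, log_mul (by linarith) (by linarith)]
    ring
  rw [setIntegral_congr_fun measurableSet_Ioi hsplit,
    integral_add (integrableOn_exp_neg_mul_mul_self_mul_log_sub_one hα)
      (integrableOn_exp_neg_mul_mul_self_mul_log_add_one hα),
    integral_exp_neg_mul_mul_self_mul_log_sub_one hα,
    integral_exp_neg_mul_mul_self_mul_log_add_one hα, integral_exp_neg_mul_div_add_one,
    log_div hα.ne' two_ne_zero]
  ring
end

section
/- Let v > 0 and K₁, K₂ > 0 be real numbers. Then the function G(y₁,y₂) = −2·√(y₁y₂)/√v + (y₁ + y₂)·(2/π)·ζ(2) − (2/π)·( y₂·Σ_{b=1}^∞ e^{−πb²y₁/(y₂v)}/b² + y₁·Σ_{c=1}^∞ e^{−πc²y₂/(y₁v)}/c² ) is integrable on the region (K₁,∞) × (K₂,∞) with respect to the measure dy₁ dy₂/(y₁² y₂²); in particular the integral ∫_{K₁}^∞ ∫_{K₂}^∞ G(y₁,y₂) dy₂ dy₁/(y₁²y₂²) is finite, even though the integrals of the individual summands (y₁+y₂)(2/π)ζ(2)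 and of the two theta-type series each diverge. -/
open Real MeasureTheory Set

lemma hasSum_one_div_pnat_sq : HasSum (fun b : ℕ+ => 1 / (b : ℝ) ^ 2) (π ^ 2 / 6) := by
  have h := hasSum_zeta_two
  rw [← PNat.coe_injective.hasSum_iff] at h
  · exact h
  · intro n hn
    have : n = 0 := by
      by_contra h0
      exact hn ⟨⟨n, Nat.pos_of_ne_zero h0⟩, rfl⟩
    simp [this]

lemma summable_pnat_rpow_neg_three_halves :
    Summable (fun b : ℕ+ => (b : ℝ) ^ (-(3 / 2) : ℝ)) :=
  (Real.summable_nat_rpow.2 (by norm_num)).comp_injective PNat.coe_injective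

/-- The deficit `ζ(2) - ∑ b ≥ 1, exp (-a b²) / b²`. -/
noncomputable def thetaDeficit (a : ℝ) : ℝ :=
  π ^ 2 / 6 - ∑' b : ℕ+, Real.exp (-(a * (b : ℝ) ^ 2)) / (b : ℝ) ^ 2

lemma exp_neg_mul_sq_div_sq_le {a : ℝ} (ha : 0 ≤ a) (b : ℕ+) :
    Real.exp (-(a * (b : ℝ) ^ 2)) / (b : ℝ) ^ 2 ≤ 1 / (b : ℝ) ^ 2 := by
  gcongr
  exact Real.exp_le_one_iff.2 (by have := sq_nonneg (b : ℝ); nlinarith)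

lemma summable_exp_neg_mul_sq_div_sq {a : ℝ} (ha : 0 ≤ a) :
    Summable (fun b : ℕ+ => Real.exp (-(a * (b : ℝ) ^ 2)) / (b : ℝ) ^ 2) :=
  hasSum_one_div_pnat_sq.summable.of_nonneg_of_le (fun _ => by positivity)
    (exp_neg_mul_sq_div_sq_le ha)

lemma continuousOn_thetaDeficit : ContinuousOn thetaDeficit (Ici 0) := by
  refine continuousOn_const.sub (continuousOn_tsum (fun b => by fun_prop)
    hasSum_one_div_pnat_sq.summable fun b a ha => ?_)
  rw [Real.norm_of_nonneg (by positivity)]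
  exact exp_neg_mul_sq_div_sq_le ha b

lemma one_sub_exp_neg_le_rpow {u : ℝ} (hu : 0 ≤ u) :
    1 - Real.exp (-u) ≤ u ^ (1 / 4 : ℝ) := by
  rcases le_total u 1 with h | h
  · have h1 := Real.add_one_le_exp (-u)
    have h2 := Real.rpow_le_rpow_of_exponent_ge' hu h (by norm_num : (0 : ℝ) ≤ 1 / 4)
      (by norm_num : (1 / 4 : ℝ) ≤ 1)
    rw [Real.rpow_one] at h2
    linarith
  · have h1 := Real.one_le_rpow h (by norm_num : (0 : ℝ) ≤ 1 / 4)
    linarith [Real.exp_pos (-u)]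

lemma abs_thetaDeficit_le {a : ℝ} (ha : 0 ≤ a) :
    |thetaDeficit a| ≤ (∑' b : ℕ+, (b : ℝ) ^ (-(3 / 2) : ℝ)) * a ^ (1 / 4 : ℝ) := by
  have hs := hasSum_one_div_pnat_sq.sub (summable_exp_neg_mul_sq_div_sq ha).hasSum
  rw [thetaDeficit, abs_of_nonneg (hs.nonneg fun b => sub_nonneg.2 (exp_neg_mul_sq_div_sq_le ha b))]
  refine hasSum_le (fun b => ?_) hs (summable_pnat_rpow_neg_three_halves.hasSum.mul_right _)
  have hb : (0 : ℝ) < b := by exact_mod_cast b.pos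
  have h := one_sub_exp_neg_le_rpow (u := a * (b : ℝ) ^ 2) (by positivity)
  rw [Real.mul_rpow ha (by positivity), ← Real.rpow_natCast, ← Real.rpow_mul hb.le] at h
  rw [← sub_div, ← Real.rpow_natCast, div_le_iff₀ (by positivity)]
  calc _ ≤ _ := h
    _ = (b : ℝ) ^ (-(3 / 2) + (2 : ℕ) : ℝ) * a ^ (1 / 4 : ℝ) := by
      rw [mul_comm]; norm_num
    _ = _ := by rw [Real.rpow_add hb]; ring

lemma integrableOn_rpow_mul_rpow_Ioi_prod {K₁ K₂ r s : ℝ} (hK₁ : 0 < K₁) (hK₂ : 0 < K₂)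
    (hr : r < -1) (hs : s < -1) :
    IntegrableOn (fun p : ℝ × ℝ => p.1 ^ r * p.2 ^ s) (Ioi K₁ ×ˢ Ioi K₂) volume := by
  rw [IntegrableOn, Measure.volume_eq_prod, ← Measure.prod_restrict]
  exact (integrableOn_Ioi_rpow_of_lt hr hK₁).mul_prod (integrableOn_Ioi_rpow_of_lt hs hK₂)

lemma integrableOn_thetaDeficit_snd {v K₁ K₂ : ℝ} (hv : 0 < v) (hK₁ : 0 < K₁) (hK₂ : 0 < K₂) :
    IntegrableOn (fun p : ℝ × ℝ =>
      p.2 * thetaDeficit (π * p.1 / (p.2 * v)) / (p.1 ^ 2 * p.2 ^ 2))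
      (Ioi K₁ ×ˢ Ioi K₂) volume := by
  have hpos : ∀ p ∈ Ioi K₁ ×ˢ Ioi K₂, 0 < p.1 ∧ 0 < p.2 := fun p hp =>
    ⟨hK₁.trans hp.1, hK₂.trans hp.2⟩
  have hmeas : MeasurableSet (Ioi K₁ ×ˢ Ioi K₂) := measurableSet_Ioi.prod measurableSet_Ioi
  refine Integrable.mono' ((integrableOn_rpow_mul_rpow_Ioi_prod hK₁ hK₂
    (by norm_num : (-(7 / 4) : ℝ) < -1) (by norm_num : (-(5 / 4) : ℝ) < -1)).const_mul
      ((∑' b : ℕ+, (b : ℝ) ^ (-(3 / 2) : ℝ)) * (π / v) ^ (1 / 4 : ℝ))) ?_ ?_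
  · refine ContinuousOn.aestronglyMeasurable ?_ hmeas
    refine ContinuousOn.div (continuousOn_snd.mul (continuousOn_thetaDeficit.comp
      (ContinuousOn.div (by fun_prop) (by fun_prop) ?_) ?_)) (by fun_prop) ?_
    all_goals intro p hp; obtain ⟨h1, h2⟩ := hpos p hp
    · positivity
    · exact mem_Ici.2 (by positivity)
    · positivity
  · refine (ae_restrict_iff' hmeas).2 (.of_forall fun p hp => ?_)
    obtain ⟨h1, h2⟩ := hpos p hp
    have h := abs_thetaDeficit_le (a := π * p.1 / (p.2 * v)) (by positivity)
    rw [norm_div, norm_mul, Real.norm_of_nonneg h2.le, Real.norm_eq_abs,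
      Real.norm_of_nonneg (by positivity), div_le_iff₀ (by positivity)]
    have e : π * p.1 / (p.2 * v) = π / v * p.1 * p.2⁻¹ := by field_simp
    have e1 : p.1 ^ (-(7 / 4) : ℝ) * p.1 ^ 2 = p.1 ^ (1 / 4 : ℝ) := by
      rw [← Real.rpow_natCast, ← Real.rpow_add h1]; norm_num
    have e2 : p.2 ^ (-(5 / 4) : ℝ) * p.2 ^ 2 = p.2 * (p.2⁻¹) ^ (1 / 4 : ℝ) := by
      rw [Real.inv_rpow h2.le, ← Real.rpow_neg h2.le, ← Real.rpow_natCast, ← Real.rpow_add h2,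
        ← Real.rpow_one_add' h2.le (by norm_num)]
      norm_num
    rw [e, Real.mul_rpow (by positivity) (by positivity),
      Real.mul_rpow (by positivity) (by positivity)] at h
    rw [e]
    refine (mul_le_mul_of_nonneg_left h h2.le).trans_eq ?_
    linear_combination (-(∑' b : ℕ+, (b : ℝ) ^ (-(3 / 2) : ℝ)) * (π / v) ^ (1 / 4 : ℝ)) *
      (p.2 ^ (-(5 / 4) : ℝ) * p.2 ^ 2 * e1 + p.1 ^ (1 / 4 : ℝ) * e2)

lemma integrableOn_thetaDeficit_fst {v K₁ K₂ : ℝ} (hv : 0 < v) (hK₁ : 0 < K₁) (hK₂ : 0 < K₂) :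
    IntegrableOn (fun p : ℝ × ℝ =>
      p.1 * thetaDeficit (π * p.2 / (p.1 * v)) / (p.1 ^ 2 * p.2 ^ 2))
      (Ioi K₁ ×ˢ Ioi K₂) volume := by
  have h := integrableOn_thetaDeficit_snd hv hK₂ hK₁
  rw [IntegrableOn, Measure.volume_eq_prod, ← Measure.prod_restrict] at h ⊢
  refine h.swap.congr (.of_forall fun p => ?_)
  simp [mul_comm]

lemma integrableOn_sqrt_mul_div {K₁ K₂ : ℝ} (hK₁ : 0 < K₁) (hK₂ : 0 < K₂) :
    IntegrableOn (fun p : ℝ × ℝ => Real.sqrt (p.1 * p.2) / (p.1 ^ 2 * p.2 ^ 2))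
      (Ioi K₁ ×ˢ Ioi K₂) volume := by
  refine (integrableOn_rpow_mul_rpow_Ioi_prod hK₁ hK₂ (by norm_num : (-(3 / 2) : ℝ) < -1)
    (by norm_num : (-(3 / 2) : ℝ) < -1)).congr_fun (fun p hp => ?_)
    (measurableSet_Ioi.prod measurableSet_Ioi)
  have key : ∀ x : ℝ, 0 < x → x ^ (-(3 / 2) : ℝ) = Real.sqrt x / x ^ 2 := fun x hx => by
    rw [Real.sqrt_eq_rpow, ← Real.rpow_natCast, ← Real.rpow_sub hx]; norm_num
  have h1 : 0 < p.1 := hK₁.trans hp.1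
  have h2 : 0 < p.2 := hK₂.trans hp.2
  simp only [key _ h1, key _ h2, Real.sqrt_mul h1.le]
  ring

/-- The zeroth boundary coefficient
`G(y₁,y₂) = −2√(y₁y₂)/√v + (y₁+y₂)(2/π)ζ(2)
  − (2/π)( y₂·Σ_{b≥1} e^{−πb²y₁/(y₂v)}/b² + y₁·Σ_{c≥1} e^{−πc²y₂/(y₁v)}/c² )`
is integrable on `(K₁,∞) × (K₂,∞)` with respect to `dy₁dy₂/(y₁²y₂²)`
(here `ζ(2) = π²/6`). -/
theorem boundary_zero_coeff_integrable (v K₁ K₂ : ℝ) (hv : 0 < v) (hK₁ : 0 < K₁)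
    (hK₂ : 0 < K₂) :
    IntegrableOn
      (fun p : ℝ × ℝ =>
        (-2 * Real.sqrt (p.1 * p.2) / Real.sqrt v +
            (p.1 + p.2) * (2 / π) * (π ^ 2 / 6) -
            2 / π *
              (p.2 * ∑' b : ℕ+, Real.exp (-(π * (b : ℝ) ^ 2 * p.1 / (p.2 * v))) / (b : ℝ) ^ 2 +
                p.1 * ∑' c : ℕ+, Real.exp (-(π * (c : ℝ) ^ 2 * p.2 / (p.1 * v))) / (c : ℝ) ^ 2)) /
          (p.1 ^ 2 * p.2 ^ 2))
      (Ioi K₁ ×ˢ Ioi K₂) volume := by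
  have h := ((integrableOn_sqrt_mul_div hK₁ hK₂).const_mul (-2 / Real.sqrt v)).add
    (((integrableOn_thetaDeficit_snd hv hK₁ hK₂).add
      (integrableOn_thetaDeficit_fst hv hK₁ hK₂)).const_mul (2 / π))
  refine h.congr (.of_forall fun p => ?_)
  have e : ∀ x y : ℝ, ∀ b : ℕ+, π * (b : ℝ) ^ 2 * x / (y * v) = π * x / (y * v) * (b : ℝ) ^ 2 :=
    fun x y b => by ring
  simp only [Pi.add_apply, thetaDeficit, e]
  ring
end
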